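/- Let 𝒟 be a family of domain-independent dependencies each of which is union closed, upwards closed, or downwards closed. Then 𝒟 is strongly first order if and only if every D ∈ 𝒟 is individually strongly first order. -/

import Mathlib

open FirstOrder FirstOrder.Language

/-- A `k`-ary dependency: an isomorphism-closed class of models `(A, R)` where `R` is a
`k`-ary relation on the domain `A`. -/
structure Dependency (k : ℕ) : Type 1 where
  Mem : ∀ (A : Type), Set (Fin k → A) → Prop
  iso_closed : ∀ {A B : Type} (e : A ≃ B) (R : Set (Fin k → A)),
    Mem A R → Mem B ((fun (t : Fin k → A) (i : Fin k) => e (t i)) '' R)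

/-- `Fld R` is the set of all elements occurring in some position of some tuple of `R`. -/
def Fld {k : ℕ} {A : Type} (R : Set (Fin k → A)) : Set A :=
  {a | ∃ t ∈ R, ∃ i, t i = a}

/-- A dependency is domain independent if `(A, R) ∈ D ↔ (Fld R, R) ∈ D`. -/
def Dependency.DomainIndependent {k : ℕ} (D : Dependency k) : Prop :=
  ∀ (A : Type) (R : Set (Fin k → A)),
    D.Mem A R ↔ D.Mem (Fld R) {t : Fin k → (Fld R) | (fun i => (t i : A)) ∈ R}

/-- A dependency is union closed if it is closed under unions of arbitrary
(possibly empty) families of relations on a fixed domain. -/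
def Dependency.UnionClosed {k : ℕ} (D : Dependency k) : Prop :=
  ∀ (A : Type) (I : Type) (R : I → Set (Fin k → A)),
    (∀ i, D.Mem A (R i)) → D.Mem A (⋃ i, R i)

def Dependency.DownwardsClosed {k : ℕ} (D : Dependency k) : Prop :=
  ∀ (A : Type) (R S : Set (Fin k → A)), D.Mem A R → S ⊆ R → D.Mem A S

def Dependency.UpwardsClosed {k : ℕ} (D : Dependency k) : Prop :=
  ∀ (A : Type) (R S : Set (Fin k → A)), D.Mem A R → R ⊆ S → D.Mem A S

def Dependency.EmptyTeamProperty {k : ℕ} (D : Dependency k) : Prop :=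
  ∀ A : Type, D.Mem A (∅ : Set (Fin k → A))

/-- `teamMap X xs` is `X(x⃗)`: the set of values of the tuple of variables `xs` over the team `X`. -/
def teamMap {M : Type} (X : Set (ℕ → M)) {n : ℕ} (xs : Fin n → ℕ) : Set (Fin n → M) :=
  {t | ∃ s ∈ X, t = fun j => s (xs j)}

/-- Formulas of `FO(𝒟)` in negation normal form, over the language `L`, with variables in `ℕ`,
where `𝒟` is the family of dependencies `(Ds i)_{i : ι}`. -/
inductive TSFormula (L : FirstOrder.Language.{0,0}) {ι : Type} (Ds : ι → (k : ℕ) × Dependency k) : Type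
  | rel {n : ℕ} (r : L.Relations n) (ts : Fin n → L.Term ℕ)
  | nrel {n : ℕ} (r : L.Relations n) (ts : Fin n → L.Term ℕ)
  | equal (t₁ t₂ : L.Term ℕ)
  | nequal (t₁ t₂ : L.Term ℕ)
  | depAtom (i : ι) (xs : Fin (Ds i).1 → ℕ)
  | conj (φ ψ : TSFormula L Ds)
  | disj (φ ψ : TSFormula L Ds)
  | ex (v : ℕ) (φ : TSFormula L Ds)
  | fa (v : ℕ) (φ : TSFormula L Ds)

variable {L : FirstOrder.Language.{0,0}} {ι : Type} {Ds : ι → (k : ℕ) × Dependency k}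

/-- Team semantics for `FO(𝒟)`. -/
def TSFormula.Sat (M : Type) [L.Structure M] : TSFormula L Ds → Set (ℕ → M) → Prop
  | .rel r ts, X => ∀ s ∈ X, Structure.RelMap r (fun i => (ts i).realize s)
  | .nrel r ts, X => ∀ s ∈ X, ¬ Structure.RelMap r (fun i => (ts i).realize s)
  | .equal t₁ t₂, X => ∀ s ∈ X, t₁.realize s = t₂.realize s
  | .nequal t₁ t₂, X => ∀ s ∈ X, t₁.realize s ≠ t₂.realize s
  | .depAtom i xs, X => (Ds i).2.Mem M (teamMap X xs)
  | .conj φ ψ, X => φ.Sat M X ∧ ψ.Sat M X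
  | .disj φ ψ, X => ∃ Y Z : Set (ℕ → M), X = Y ∪ Z ∧ φ.Sat M Y ∧ ψ.Sat M Z
  | .ex v φ, X => ∃ H : (ℕ → M) → Set M, (∀ s ∈ X, (H s).Nonempty) ∧
      φ.Sat M {s' | ∃ s ∈ X, ∃ m ∈ H s, s' = Function.update s v m}
  | .fa v φ, X => φ.Sat M {s' | ∃ s ∈ X, ∃ m : M, s' = Function.update s v m}

/-- The set of variables of a first-order term. -/
def termVars : L.Term ℕ → Set ℕ
  | .var x => {x}
  | .func _f ts => ⋃ i, termVars (ts i)

/-- The free variables of a team-semantics formula. -/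
def TSFormula.freeVars : TSFormula L Ds → Set ℕ
  | .rel _ ts => ⋃ i, termVars (ts i)
  | .nrel _ ts => ⋃ i, termVars (ts i)
  | .equal t₁ t₂ => termVars t₁ ∪ termVars t₂
  | .nequal t₁ t₂ => termVars t₁ ∪ termVars t₂
  | .depAtom _ xs => Set.range xs
  | .conj φ ψ => φ.freeVars ∪ ψ.freeVars
  | .disj φ ψ => φ.freeVars ∪ ψ.freeVars
  | .ex v φ => φ.freeVars \ {v}
  | .fa v φ => φ.freeVars \ {v}

/-- A sentence of `FO(𝒟)` is true in `M` iff it is satisfied by the team containing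
only one assignment (for sentences, the choice of assignment is irrelevant). -/
def TSFormula.TrueIn (M : Type) [L.Structure M] (φ : TSFormula L Ds) : Prop :=
  ∀ s : ℕ → M, φ.Sat M {s}

/-- A family of dependencies is strongly first order iff every sentence of `FO(𝒟)`,
over any (Type-0) signature, is equivalent to some first-order sentence. -/
def StronglyFirstOrderFamily {ι : Type} (Ds : ι → (k : ℕ) × Dependency k) : Prop :=
  ∀ (L : FirstOrder.Language.{0,0}) (φ : TSFormula L Ds), φ.freeVars = ∅ →
    ∃ ψ : L.Sentence, ∀ (M : Type) [L.Structure M] [Nonempty M],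
      (φ.TrueIn M ↔ Sentence.Realize M ψ)

/-- A single dependency is strongly first order iff every sentence of `FO(D)`
is equivalent to some first-order sentence. -/
def StronglyFirstOrder {k : ℕ} (D : Dependency k) : Prop :=
  StronglyFirstOrderFamily (fun _ : Unit => ⟨k, D⟩)

/-! ### Patterns -/

/-- A pattern prescribes finitely many pairwise distinct parameters, the equality types over them
that tuples of a relation may have, and some tuples of parameters that must be present. -/
structure Pattern (k : ℕ) : Type where
  size : ℕ
  types : Set ((Fin k → Fin k → Prop) × (Fin k → Fin size → Prop))
  base : Set (Fin k → Fin size)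

/-- The equality type of the tuple `t` over the parameters `a`. -/
def eqType {k m : ℕ} {A : Type} (t : Fin k → A) (a : Fin m → A) :
    (Fin k → Fin k → Prop) × (Fin k → Fin m → Prop) :=
  (fun i j => t i = t j, fun i l => t i = a l)

/-- The relation `R` matches the pattern `p` with parameters `a`. -/
def Pattern.MatchAt {k : ℕ} (p : Pattern k) {A : Type} (R : Set (Fin k → A))
    (a : Fin p.size → A) : Prop :=
  Function.Injective a ∧ (∀ t ∈ R, eqType t a ∈ p.types) ∧ ∀ u ∈ p.base, a ∘ u ∈ R

/-- A dependency is pattern definable if it holds exactly of the relations that match one of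
finitely many patterns. -/
def Dependency.PatternDefinable {k : ℕ} (D : Dependency k) : Prop :=
  ∃ P : Finset (Pattern k), ∀ (A : Type) [Nonempty A] (R : Set (Fin k → A)),
    D.Mem A R ↔ ∃ p ∈ P, ∃ a, p.MatchAt R a

section Elimination

theorem exists_formula_injective (L : FirstOrder.Language.{0,0}) (m : ℕ) :
    ∃ C : L.Formula (Fin m), ∀ (M : Type) [L.Structure M] (e : Fin m → M),
      C.Realize e ↔ Function.Injective e := by
  classical
  refine ⟨Formula.iInf fun q : Fin m × Fin m =>
    if q.1 = q.2 then ⊤ else ((Term.var q.1).equal (Term.var q.2)).not, fun M _ e => ?_⟩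
  rw [Formula.realize_iInf]
  constructor
  · intro h i j hij
    by_contra hne
    have := h (i, j)
    simp [hne, hij] at this
  · rintro h ⟨i, j⟩
    by_cases hij : i = j
    · simp [hij, Formula.realize_top]
    · simpa [hij] using fun h' => hij (h h')

theorem exists_formula_eqType (L : FirstOrder.Language.{0,0}) {k m : ℕ} (xs : Fin k → ℕ)
    (T : Set ((Fin k → Fin k → Prop) × (Fin k → Fin m → Prop))) :
    ∃ F : L.Formula (Fin m ⊕ ℕ), ∀ (M : Type) [L.Structure M] (e : Fin m → M) (s : ℕ → M),
      F.Realize (Sum.elim e s) ↔ eqType (fun i => s (xs i)) e ∈ T := by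
  classical
  refine ⟨Formula.iSup fun τ : T =>
    (Formula.iInf fun q : Fin k × Fin k =>
      if τ.1.1 q.1 q.2 then (Term.var (Sum.inr (xs q.1))).equal (Term.var (Sum.inr (xs q.2)))
      else ((Term.var (Sum.inr (xs q.1))).equal (Term.var (Sum.inr (xs q.2)))).not) ⊓
    (Formula.iInf fun q : Fin k × Fin m =>
      if τ.1.2 q.1 q.2 then (Term.var (Sum.inr (xs q.1))).equal (Term.var (Sum.inl q.2))
      else ((Term.var (Sum.inr (xs q.1))).equal (Term.var (Sum.inl q.2))).not), fun M _ e s => ?_⟩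
  have key : ∀ (c : Prop) (t₁ t₂ : L.Term (Fin m ⊕ ℕ)),
      (if c then t₁.equal t₂ else (t₁.equal t₂).not).Realize (Sum.elim e s) ↔
        ((t₁.realize (Sum.elim e s) = t₂.realize (Sum.elim e s)) = c) := by
    intro c t₁ t₂
    by_cases hc : c <;> simp [hc]
  simp only [Formula.realize_iSup, Formula.realize_inf, Formula.realize_iInf, key,
    Term.realize_var, Sum.elim_inl, Sum.elim_inr]
  constructor
  · rintro ⟨⟨τ, hτ⟩, h₁, h₂⟩
    have : eqType (fun i => s (xs i)) e = τ := by
      ext i j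
      · exact iff_of_eq (h₁ (i, j))
      · exact iff_of_eq (h₂ (i, j))
    rwa [this]
  · exact fun h => ⟨⟨_, h⟩, fun _ => rfl, fun _ => rfl⟩

/-- The property `Φ` of teams is given by a normal form: for some choice among finitely many
disjuncts and some values of finitely many parameters, the parameters satisfy a first-order
condition, all members of the team satisfy a first-order condition, and for each of finitely many
further first-order conditions some member of the team satisfies it. -/
def HasNormalForm (L : FirstOrder.Language.{0,0})
    (Φ : ∀ (M : Type) [L.Structure M], Set (ℕ → M) → Prop) : Prop :=
  ∃ (J : Type) (_ : Finite J) (β : J → Type) (_ : ∀ j, Finite (β j))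
    (κ : J → Type) (_ : ∀ j, Finite (κ j)) (C : ∀ j, L.Formula (β j))
    (F : ∀ j, L.Formula (β j ⊕ ℕ)) (G : ∀ j, κ j → L.Formula (β j ⊕ ℕ)),
    ∀ (M : Type) [L.Structure M] [Nonempty M] (X : Set (ℕ → M)), Φ M X ↔
      ∃ (j : J) (e : β j → M), (C j).Realize e ∧ (∀ s ∈ X, (F j).Realize (Sum.elim e s)) ∧
        ∀ r, ∃ s ∈ X, (G j r).Realize (Sum.elim e s)

variable {Φ Ψ : ∀ (M : Type) [L.Structure M], Set (ℕ → M) → Prop}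

theorem hasNormalForm_flat (F : L.Formula ℕ) :
    HasNormalForm L fun _ _ X => ∀ s ∈ X, F.Realize s := by
  refine ⟨Unit, inferInstance, fun _ => Empty, fun _ => inferInstance, fun _ => Empty,
    fun _ => inferInstance, fun _ => ⊤, fun _ => F.relabel Sum.inr, fun _ => Empty.elim,
    fun M _ _ X => ?_⟩
  simp only [Formula.realize_relabel, Formula.realize_top]
  constructor
  · exact fun h => ⟨(), Empty.elim, trivial, fun s hs => by simpa [Function.comp_def] using h s hs,
      fun r => r.elim⟩
  · rintro ⟨_, e, _, h, _⟩ s hs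
    simpa [Function.comp_def] using h s hs

theorem HasNormalForm.of_patternDefinable {k : ℕ} {D : Dependency k} (hD : D.PatternDefinable)
    (xs : Fin k → ℕ) : HasNormalForm L fun M _ X => D.Mem M (teamMap X xs) := by
  classical
  obtain ⟨P, hP⟩ := hD
  choose C hC using exists_formula_injective L
  choose F hF using fun m T => exists_formula_eqType L (m := m) xs T
  refine ⟨P, inferInstance, fun p => Fin p.1.size, fun _ => inferInstance, fun p => p.1.base,
    fun _ => inferInstance, fun p => C p.1.size, fun p => F _ p.1.types,
    fun p u => Formula.iInf fun i => (Term.var (Sum.inr (xs i))).equal (Term.var (Sum.inl (u.1 i))),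
    fun M _ _ X => ?_⟩
  simp only [hP, hC, hF, Formula.realize_iInf, Formula.realize_equal, Term.realize_var,
    Sum.elim_inl, Sum.elim_inr]
  constructor
  · rintro ⟨p, hp, a, ha, h₁, h₂⟩
    refine ⟨⟨p, hp⟩, a, ha, fun s hs => h₁ _ ⟨s, hs, rfl⟩, fun u => ?_⟩
    obtain ⟨s, hs, h⟩ := h₂ u.1 u.2
    exact ⟨s, hs, fun i => (congrFun h i).symm⟩
  · rintro ⟨⟨p, hp⟩, a, ha, h₁, h₂⟩
    refine ⟨p, hp, a, ha, ?_, fun u hu => ?_⟩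
    · rintro t ⟨s, hs, rfl⟩
      exact h₁ s hs
    · obtain ⟨s, hs, h⟩ := h₂ ⟨u, hu⟩
      exact ⟨s, hs, funext fun i => (h i).symm⟩

/-- Renaming of the parameters of a formula along the left injection. -/
def leftParams {β β' : Type} (F : L.Formula (β ⊕ ℕ)) : L.Formula ((β ⊕ β') ⊕ ℕ) :=
  F.relabel (Sum.map Sum.inl id)

/-- Renaming of the parameters of a formula along the right injection. -/
def rightParams {β β' : Type} (F : L.Formula (β' ⊕ ℕ)) : L.Formula ((β ⊕ β') ⊕ ℕ) :=
  F.relabel (Sum.map Sum.inr id)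

theorem realize_leftParams {β β' M : Type} [L.Structure M] (F : L.Formula (β ⊕ ℕ))
    (e : β ⊕ β' → M) (s : ℕ → M) :
    (leftParams F).Realize (Sum.elim e s) ↔ F.Realize (Sum.elim (e ∘ Sum.inl) s) := by
  rw [leftParams, Formula.realize_relabel, Sum.elim_comp_map]
  rfl

theorem realize_rightParams {β β' M : Type} [L.Structure M] (F : L.Formula (β' ⊕ ℕ))
    (e : β ⊕ β' → M) (s : ℕ → M) :
    (rightParams F).Realize (Sum.elim e s) ↔ F.Realize (Sum.elim (e ∘ Sum.inr) s) := by
  rw [rightParams, Formula.realize_relabel, Sum.elim_comp_map]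
  rfl

theorem HasNormalForm.conj (hΦ : HasNormalForm L Φ) (hΨ : HasNormalForm L Ψ) :
    HasNormalForm L fun M _ X => Φ M X ∧ Ψ M X := by
  obtain ⟨J, _, β, _, κ, _, C, F, G, h⟩ := hΦ
  obtain ⟨J', _, β', _, κ', _, C', F', G', h'⟩ := hΨ
  refine ⟨J × J', inferInstance, fun j => β j.1 ⊕ β' j.2, fun _ => inferInstance,
    fun j => κ j.1 ⊕ κ' j.2, fun _ => inferInstance,
    fun j => (C j.1).relabel Sum.inl ⊓ (C' j.2).relabel Sum.inr,
    fun j => leftParams (F j.1) ⊓ rightParams (F' j.2),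
    fun j => Sum.elim (fun r => leftParams (G j.1 r)) (fun r => rightParams (G' j.2 r)),
    fun M _ _ X => ?_⟩
  simp only [h, h', Formula.realize_inf, Formula.realize_relabel, realize_leftParams,
    realize_rightParams, Sum.forall, Sum.elim_inl, Sum.elim_inr]
  constructor
  · rintro ⟨⟨j, e, hC, hF, hG⟩, j', e', hC', hF', hG'⟩
    exact ⟨(j, j'), Sum.elim e e', ⟨hC, hC'⟩, fun s hs => ⟨hF s hs, hF' s hs⟩, hG, hG'⟩
  · rintro ⟨⟨j, j'⟩, e, ⟨hC, hC'⟩, hF, hG, hG'⟩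
    exact ⟨⟨j, e ∘ Sum.inl, hC, fun s hs => (hF s hs).1, hG⟩,
      j', e ∘ Sum.inr, hC', fun s hs => (hF s hs).2, hG'⟩

theorem HasNormalForm.disj (hΦ : HasNormalForm L Φ) (hΨ : HasNormalForm L Ψ) :
    HasNormalForm L fun M _ X => ∃ Y Z : Set (ℕ → M), X = Y ∪ Z ∧ Φ M Y ∧ Ψ M Z := by
  obtain ⟨J, _, β, _, κ, _, C, F, G, h⟩ := hΦ
  obtain ⟨J', _, β', _, κ', _, C', F', G', h'⟩ := hΨ
  refine ⟨J × J', inferInstance, fun j => β j.1 ⊕ β' j.2, fun _ => inferInstance,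
    fun j => κ j.1 ⊕ κ' j.2, fun _ => inferInstance,
    fun j => (C j.1).relabel Sum.inl ⊓ (C' j.2).relabel Sum.inr,
    fun j => leftParams (F j.1) ⊔ rightParams (F' j.2),
    fun j => Sum.elim (fun r => leftParams (F j.1 ⊓ G j.1 r))
      (fun r => rightParams (F' j.2 ⊓ G' j.2 r)),
    fun M _ _ X => ?_⟩
  simp only [h, h', Formula.realize_inf, Formula.realize_sup, Formula.realize_relabel,
    realize_leftParams, realize_rightParams, Sum.forall, Sum.elim_inl, Sum.elim_inr]
  constructor
  · rintro ⟨Y, Z, rfl, ⟨j, e, hC, hF, hG⟩, j', e', hC', hF', hG'⟩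
    refine ⟨(j, j'), Sum.elim e e', ⟨hC, hC'⟩, ?_, fun r => ?_, fun r => ?_⟩
    · rintro s (hs | hs)
      · exact Or.inl (hF s hs)
      · exact Or.inr (hF' s hs)
    · obtain ⟨s, hs, hr⟩ := hG r
      exact ⟨s, Or.inl hs, hF s hs, hr⟩
    · obtain ⟨s, hs, hr⟩ := hG' r
      exact ⟨s, Or.inr hs, hF' s hs, hr⟩
  · rintro ⟨⟨j, j'⟩, e, ⟨hC, hC'⟩, hF, hG, hG'⟩
    refine ⟨{s ∈ X | (F j).Realize (Sum.elim (e ∘ Sum.inl) s)},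
      {s ∈ X | (F' j').Realize (Sum.elim (e ∘ Sum.inr) s)}, ?_,
      ⟨j, e ∘ Sum.inl, hC, fun s hs => hs.2, fun r => ?_⟩,
      j', e ∘ Sum.inr, hC', fun s hs => hs.2, fun r => ?_⟩
    · ext s
      have := hF s
      simp only [Set.mem_union, Set.mem_ofPred_eq]
      tauto
    · obtain ⟨s, hs, h₁, h₂⟩ := hG r
      exact ⟨s, ⟨hs, h₁⟩, h₂⟩
    · obtain ⟨s, hs, h₁, h₂⟩ := hG' r
      exact ⟨s, ⟨hs, h₁⟩, h₂⟩

/-- Existential quantification of the variable `v`. -/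
noncomputable def exVar {β : Type} (v : ℕ) (F : L.Formula (β ⊕ ℕ)) : L.Formula (β ⊕ ℕ) :=
  (F.relabel (Sum.elim (fun b => Sum.inl (Sum.inl b))
    fun n => if n = v then Sum.inr () else Sum.inl (Sum.inr n)) :
      L.Formula ((β ⊕ ℕ) ⊕ Unit)).iExs Unit

theorem realize_exVar {β M : Type} [L.Structure M] (v : ℕ) (F : L.Formula (β ⊕ ℕ))
    (e : β → M) (s : ℕ → M) :
    (exVar v F).Realize (Sum.elim e s) ↔
      ∃ m, F.Realize (Sum.elim e (Function.update s v m)) := by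
  have key : ∀ i : Unit → M, (Sum.elim (Sum.elim e s) i ∘ Sum.elim (fun b => Sum.inl (Sum.inl b))
      (fun n => if n = v then Sum.inr () else Sum.inl (Sum.inr n)) : β ⊕ ℕ → M) =
      Sum.elim e (Function.update s v (i ())) := by
    intro i
    ext (b | n)
    · rfl
    · by_cases hn : n = v <;> simp [hn, Function.update]
  simp only [exVar, Formula.realize_iExs, Formula.realize_relabel, key]
  exact ⟨fun ⟨i, hi⟩ => ⟨i (), hi⟩, fun ⟨m, hm⟩ => ⟨fun _ => m, hm⟩⟩

theorem HasNormalForm.ex (hΦ : HasNormalForm L Φ) (v : ℕ) :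
    HasNormalForm L fun M _ X => ∃ H : (ℕ → M) → Set M, (∀ s ∈ X, (H s).Nonempty) ∧
      Φ M {s' | ∃ s ∈ X, ∃ m ∈ H s, s' = Function.update s v m} := by
  obtain ⟨J, _, β, _, κ, _, C, F, G, h⟩ := hΦ
  refine ⟨J, inferInstance, β, inferInstance, κ, inferInstance, C, fun j => exVar v (F j),
    fun j r => exVar v (F j ⊓ G j r), fun M _ _ X => ?_⟩
  simp only [h, realize_exVar, Formula.realize_inf]
  constructor
  · rintro ⟨H, hH, j, e, hC, hF, hG⟩
    refine ⟨j, e, hC, fun s hs => ?_, fun r => ?_⟩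
    · obtain ⟨m, hm⟩ := hH s hs
      exact ⟨m, hF _ ⟨s, hs, m, hm, rfl⟩⟩
    · obtain ⟨_, ⟨s, hs, m, hm, rfl⟩, hr⟩ := hG r
      exact ⟨s, hs, m, hF _ ⟨s, hs, m, hm, rfl⟩, hr⟩
  · rintro ⟨j, e, hC, hF, hG⟩
    refine ⟨fun s => {m | (F j).Realize (Sum.elim e (Function.update s v m))}, hF, j, e, hC, ?_,
      fun r => ?_⟩
    · rintro _ ⟨s, hs, m, hm, rfl⟩
      exact hm
    · obtain ⟨s, hs, m, hm, hr⟩ := hG r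
      exact ⟨_, ⟨s, hs, m, hm, rfl⟩, hr⟩

theorem HasNormalForm.fa (hΦ : HasNormalForm L Φ) (v : ℕ) :
    HasNormalForm L fun M _ X =>
      Φ M {s' | ∃ s ∈ X, ∃ m : M, s' = Function.update s v m} := by
  obtain ⟨J, _, β, _, κ, _, C, F, G, h⟩ := hΦ
  refine ⟨J, inferInstance, β, inferInstance, κ, inferInstance, C,
    fun j => (exVar v (F j).not).not, fun j r => exVar v (G j r), fun M _ _ X => ?_⟩
  simp only [h, realize_exVar, Formula.realize_not, not_exists, not_not]
  refine exists_congr fun j => exists_congr fun e => and_congr_right fun _ => and_congr ?_ ?_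
  · exact ⟨fun hF s hs m => hF _ ⟨s, hs, m, rfl⟩, by rintro hF _ ⟨s, hs, m, rfl⟩; exact hF s hs m⟩
  · refine forall_congr' fun r => ⟨?_, ?_⟩
    · rintro ⟨_, ⟨s, hs, m, rfl⟩, hr⟩
      exact ⟨s, hs, m, hr⟩
    · rintro ⟨s, hs, m, hr⟩
      exact ⟨_, ⟨s, hs, m, rfl⟩, hr⟩

theorem TSFormula.hasNormalForm (hD : ∀ i, (Ds i).2.PatternDefinable) (φ : TSFormula L Ds) :
    HasNormalForm L fun M _ X => φ.Sat M X := by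
  induction φ with
  | rel r ts =>
    simpa only [TSFormula.Sat, Formula.realize_rel] using hasNormalForm_flat (r.formula ts)
  | nrel r ts =>
    simpa only [TSFormula.Sat, Formula.realize_rel, Formula.realize_not] using
      hasNormalForm_flat (r.formula ts).not
  | equal t₁ t₂ =>
    simpa only [TSFormula.Sat, Formula.realize_equal] using hasNormalForm_flat (t₁.equal t₂)
  | nequal t₁ t₂ =>
    simpa only [TSFormula.Sat, Formula.realize_equal, Formula.realize_not] using
      hasNormalForm_flat (t₁.equal t₂).not
  | depAtom i xs => exact HasNormalForm.of_patternDefinable (hD i) xs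
  | conj φ ψ hφ hψ => exact hφ.conj hψ
  | disj φ ψ hφ hψ => exact hφ.disj hψ
  | ex v φ hφ => exact hφ.ex v
  | fa v φ hφ => exact hφ.fa v

theorem HasNormalForm.exists_formula_singleton (hΦ : HasNormalForm L Φ) :
    ∃ ψ : L.Formula ℕ, ∀ (M : Type) [L.Structure M] [Nonempty M] (s : ℕ → M),
      Φ M {s} ↔ ψ.Realize s := by
  obtain ⟨J, _, β, _, κ, _, C, F, G, h⟩ := hΦ
  refine ⟨Formula.iSup fun j => (((C j).relabel Sum.inl ⊓ F j ⊓ Formula.iInf (G j)).relabel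
    (Sum.swap) : L.Formula (ℕ ⊕ β j)).iExs (β j), fun M _ _ s => ?_⟩
  have key : ∀ j (e : β j → M), Sum.elim s e ∘ Sum.swap = Sum.elim e s := by
    intro j e
    ext (_ | _) <;> rfl
  simp only [h, Formula.realize_iSup, Formula.realize_iExs, Formula.realize_relabel, key,
    Formula.realize_inf, Formula.realize_iInf, Sum.elim_comp_inl, Set.mem_singleton_iff,
    forall_eq, exists_eq_left, and_assoc]

theorem StronglyFirstOrderFamily.of_patternDefinable (hD : ∀ i, (Ds i).2.PatternDefinable) :
    StronglyFirstOrderFamily Ds := by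
  intro L φ _
  obtain ⟨ψ, hψ⟩ := (φ.hasNormalForm hD).exists_formula_singleton
  refine ⟨ψ.not.exClosure.not, fun M _ _ => ?_⟩
  have h₁ : Sentence.Realize M ψ.not.exClosure.not ↔ ¬ Sentence.Realize M ψ.not.exClosure :=
    Iff.rfl
  rw [h₁, Formula.realize_exClosure, TSFormula.TrueIn]
  constructor
  · rintro h ⟨v, hv⟩
    let v' : ℕ → M := fun n => if hn : n ∈ ψ.not.freeVarFinset then v ⟨n, hn⟩
      else Classical.arbitrary M
    have := (BoundedFormula.realize_restrictFreeVar v' (fun a => by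
      simp only [v', dif_pos a.2, id])).1 hv
    exact this ((hψ M v').1 (h v'))
  · intro h s
    rw [hψ]
    by_contra hs
    exact h ⟨fun a => s a, (BoundedFormula.realize_restrictFreeVar (φ := ψ.not) (f := id) s
      (fun _ => rfl)).2 hs⟩

end Elimination

/-! ### Domain independence -/

section DomainIndependence

variable {k : ℕ} {D : Dependency k} {A B : Type} {R : Set (Fin k → A)}

theorem mem_fld {t : Fin k → A} (ht : t ∈ R) (i : Fin k) : t i ∈ Fld R := ⟨t, ht, i, rfl⟩

theorem fld_mono {S : Set (Fin k → A)} (h : R ⊆ S) : Fld R ⊆ Fld S := by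
  rintro _ ⟨t, ht, i, rfl⟩
  exact mem_fld (h ht) i

theorem fld_image (h : A → B) : Fld ((h ∘ ·) '' R) = h '' Fld R := by
  ext b
  constructor
  · rintro ⟨_, ⟨t, ht, rfl⟩, i, rfl⟩
    exact ⟨_, mem_fld ht i, rfl⟩
  · rintro ⟨_, ⟨t, ht, i, rfl⟩, rfl⟩
    exact ⟨_, ⟨t, ht, rfl⟩, i, rfl⟩

theorem Dependency.mem_equiv_iff (D : Dependency k) (e : A ≃ B) (R : Set (Fin k → A)) :
    D.Mem B ((e ∘ ·) '' R) ↔ D.Mem A R := by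
  refine ⟨fun h => ?_, D.iso_closed e R⟩
  have := D.iso_closed e.symm _ h
  rw [Set.image_image] at this
  convert this
  ext t
  simp

theorem Dependency.DomainIndependent.mem_image_iff (hD : D.DomainIndependent) {h : A → B}
    (hh : Set.InjOn h (Fld R)) : D.Mem B ((h ∘ ·) '' R) ↔ D.Mem A R := by
  rw [hD A R, hD B]
  have hbij : Set.BijOn h (Fld R) (Fld ((h ∘ ·) '' R)) :=
    fld_image (R := R) h ▸ hh.bijOn_image
  rw [← D.mem_equiv_iff (Set.BijOn.equiv h hbij)]
  apply iff_of_eq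
  congr 1
  ext t
  constructor
  · rintro ⟨t', ht', h'⟩
    refine ⟨fun i => ⟨t' i, mem_fld ht' i⟩, ht', ?_⟩
    ext i
    exact congrFun h' i
  · rintro ⟨t', ht', rfl⟩
    exact ⟨_, ht', rfl⟩

theorem Dependency.DomainIndependent.mem_image_injective_iff (hD : D.DomainIndependent) {h : A → B}
    (hh : Function.Injective h) : D.Mem B ((h ∘ ·) '' R) ↔ D.Mem A R :=
  hD.mem_image_iff hh.injOn

end DomainIndependence

section Subfamily

/-- The formula of `FO(Ds)` obtained from a formula of `FO(Ds i)`. -/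
def TSFormula.ofSingle (i : ι) : TSFormula L (fun _ : Unit => Ds i) → TSFormula L Ds
  | .rel r ts => .rel r ts
  | .nrel r ts => .nrel r ts
  | .equal t₁ t₂ => .equal t₁ t₂
  | .nequal t₁ t₂ => .nequal t₁ t₂
  | .depAtom _ xs => .depAtom i xs
  | .conj φ ψ => .conj (φ.ofSingle i) (ψ.ofSingle i)
  | .disj φ ψ => .disj (φ.ofSingle i) (ψ.ofSingle i)
  | .ex v φ => .ex v (φ.ofSingle i)
  | .fa v φ => .fa v (φ.ofSingle i)

theorem TSFormula.sat_ofSingle (i : ι) (M : Type) [L.Structure M]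
    (φ : TSFormula L (fun _ : Unit => Ds i)) (X : Set (ℕ → M)) :
    (φ.ofSingle i).Sat M X ↔ φ.Sat M X := by
  induction φ generalizing X with
  | rel | nrel | equal | nequal | depAtom => rfl
  | conj φ ψ h₁ h₂ | disj φ ψ h₁ h₂ => simp only [ofSingle, Sat, h₁, h₂]
  | ex v φ h | fa v φ h => simp only [ofSingle, Sat, h]

theorem TSFormula.freeVars_ofSingle (i : ι) (φ : TSFormula L (fun _ : Unit => Ds i)) :
    (φ.ofSingle i).freeVars = φ.freeVars := by
  induction φ with
  | rel | nrel | equal | nequal | depAtom => rfl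
  | conj φ ψ h₁ h₂ | disj φ ψ h₁ h₂ => simp only [ofSingle, freeVars, h₁, h₂]
  | ex v φ h | fa v φ h => simp only [ofSingle, freeVars, h]

theorem StronglyFirstOrderFamily.stronglyFirstOrder (h : StronglyFirstOrderFamily Ds) (i : ι) :
    StronglyFirstOrder (Ds i).2 := by
  intro L (φ : TSFormula L (fun _ : Unit => Ds i)) hφ
  obtain ⟨ψ, hψ⟩ := h L (φ.ofSingle i) (by rwa [TSFormula.freeVars_ofSingle])
  refine ⟨ψ, fun M _ _ => ?_⟩
  rw [← hψ]
  exact forall_congr' fun s => (φ.sat_ofSingle i M {s}).symm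

end Subfamily

/-! ### Selections -/

section Selection

variable {k : ℕ} {D : Dependency k}

/-- Every `u` can be given a nonempty set of options `v` permitted by `Opt`, in such a way that
the union of the relations `O v` over all selected options satisfies `D`. -/
def Dependency.Selectable (D : Dependency k) {M : Type} (Opt : M → M → Prop)
    (O : M → Set (Fin k → M)) : Prop :=
  ∃ H : M → Set M, (∀ u, (H u).Nonempty) ∧ (∀ u, ∀ v ∈ H u, Opt u v) ∧
    D.Mem M {t | ∃ u, ∃ v ∈ H u, t ∈ O v}

inductive SelectionRel (k : ℕ) : ℕ → Type
  | opt : SelectionRel k 2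
  | option : SelectionRel k (k + 1)

/-- The language with a binary relation symbol and a `(k + 1)`-ary relation symbol. -/
def selectionLanguage (k : ℕ) : FirstOrder.Language.{0, 0} := ⟨fun _ => Empty, SelectionRel k⟩

/-- The structure of the language `selectionLanguage k` given by `Opt` and `O`. -/
@[reducible]
def selectionStructure {M : Type} (Opt : M → M → Prop) (O : M → Set (Fin k → M)) :
    (selectionLanguage k).Structure M where
  funMap f := f.elim
  RelMap {_} r := match r with
    | .opt => fun x => Opt (x 0) (x 1)
    | .option => fun x => Fin.tail x ∈ O (x 0)

/-- Universal quantification over all variables below `n`. -/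
def TSFormula.faBelow : ℕ → TSFormula L Ds → TSFormula L Ds
  | 0, φ => φ
  | n + 1, φ => .fa n (φ.faBelow n)

theorem TSFormula.freeVars_faBelow (n : ℕ) (φ : TSFormula L Ds) :
    (φ.faBelow n).freeVars = φ.freeVars \ Set.Iio n := by
  induction n with
  | zero => simp [faBelow]
  | succ n h =>
    ext j
    simp only [faBelow, freeVars, h, Set.mem_sdiff, Set.mem_Iio, Set.mem_singleton_iff, and_assoc]
    refine and_congr_right fun _ => ?_
    omega

theorem TSFormula.sat_faBelow (M : Type) [L.Structure M] (n : ℕ) (φ : TSFormula L Ds)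
    (X : Set (ℕ → M)) :
    (φ.faBelow n).Sat M X ↔ φ.Sat M {s' | ∃ s ∈ X, ∀ j, n ≤ j → s' j = s j} := by
  induction n generalizing X with
  | zero =>
    have : {s' | ∃ s ∈ X, ∀ j, 0 ≤ j → s' j = s j} = X := by
      ext s'
      refine ⟨fun ⟨s, hs, h⟩ => ?_, fun h => ⟨s', h, fun _ _ => rfl⟩⟩
      rwa [show s' = s from funext fun j => h j j.zero_le]
    rw [this, faBelow]
  | succ n h =>
    rw [faBelow, Sat, h]
    apply iff_of_eq
    congr 1
    ext s'
    constructor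
    · rintro ⟨_, ⟨s, hs, m, rfl⟩, h'⟩
      refine ⟨s, hs, fun j hj => ?_⟩
      rw [h' j (by omega), Function.update_of_ne (by omega)]
    · rintro ⟨s, hs, h'⟩
      refine ⟨_, ⟨s, hs, s' n, rfl⟩, fun j hj => ?_⟩
      rcases hj.eq_or_lt with rfl | hj
      · simp
      · rw [h' j hj, Function.update_of_ne (by omega)]

/-- The sentence of `FO(D)` that defines selectability. -/
def selectionFormula (D : Dependency k) :
    TSFormula (selectionLanguage k) (fun _ : Unit => ⟨k, D⟩) :=
  .fa k <| .ex (k + 1) <| .faBelow k <| .conj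
    (.rel (n := 2) SelectionRel.opt ![.var k, .var (k + 1)])
    (.disj
      (.nrel (n := k + 1) SelectionRel.option (Fin.cons (.var (k + 1)) fun j : Fin k => .var j))
      (.conj
        (.rel (n := k + 1) SelectionRel.option (Fin.cons (.var (k + 1)) fun j : Fin k => .var j))
        (.depAtom () fun j : Fin k => j)))

theorem freeVars_selectionFormula (D : Dependency k) : (selectionFormula D).freeVars = ∅ := by
  ext j
  simp only [selectionFormula, TSFormula.freeVars, TSFormula.freeVars_faBelow, Set.mem_sdiff,
    Set.mem_union, Set.mem_iUnion, Set.mem_range, Fin.exists_fin_succ, Fin.cons_zero,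
    Fin.cons_succ, termVars, Set.mem_singleton_iff, Set.mem_Iio, Set.mem_empty_iff_false,
    iff_false]
  rintro ⟨⟨⟨h, h₁⟩, h₂⟩, h₃⟩
  have aux : ∀ i : Fin k, j ≠ i := fun i => by omega
  have aux' : ∀ i : Fin k, (i : ℕ) ≠ j := fun i => by omega
  simp_all [termVars]

theorem trueIn_selectionFormula (D : Dependency k) (M : Type) [Nonempty M]
    [(selectionLanguage k).Structure M] {Opt : M → M → Prop} {O : M → Set (Fin k → M)}
    (hOpt : ∀ x : Fin 2 → M, Structure.RelMap (L := selectionLanguage k) SelectionRel.opt x ↔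
      Opt (x 0) (x 1))
    (hO : ∀ x : Fin (k + 1) → M, Structure.RelMap (L := selectionLanguage k) SelectionRel.option x ↔
      Fin.tail x ∈ O (x 0)) :
    (selectionFormula D).TrueIn M ↔ D.Selectable Opt O := by
  have h_opt : ∀ (s : ℕ → M), Structure.RelMap (L := selectionLanguage k) (n := 2)
      SelectionRel.opt (fun i => Term.realize (L := selectionLanguage k) s
        ((![.var k, .var (k + 1)] : Fin 2 → (selectionLanguage k).Term ℕ) i)) ↔
      Opt (s k) (s (k + 1)) := fun s => hOpt _
  have h_sel : ∀ (s : ℕ → M), Structure.RelMap (L := selectionLanguage k) (n := k + 1)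
      SelectionRel.option (fun i => Term.realize (L := selectionLanguage k) s
        ((Fin.cons (.var (k + 1)) fun j : Fin k => .var j :
          Fin (k + 1) → (selectionLanguage k).Term ℕ) i)) ↔
      (fun j : Fin k => s j) ∈ O (s (k + 1)) := fun s => hO _
  simp only [TSFormula.TrueIn, selectionFormula, TSFormula.Sat, TSFormula.sat_faBelow, h_opt,
    h_sel]
  let asg (s : ℕ → M) (t : Fin k → M) (u v : M) : ℕ → M := fun j =>
    if h : j < k then t ⟨j, h⟩ else if j = k then u else if j = k + 1 then v else s j
  have asg_lt : ∀ s t u v, (fun j : Fin k => asg s t u v j) = t := fun s t u v => by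
    ext j
    simp [asg]
  have asg_u : ∀ s t u v, asg s t u v k = u := fun s t u v => by simp [asg]
  have asg_v : ∀ s t u v, asg s t u v (k + 1) = v := fun s t u v => by simp [asg]
  have asg_ge : ∀ s t u v j, k ≤ j → asg s t u v j =
      Function.update (Function.update s k u) (k + 1) v j := fun s t u v j hj => by
    by_cases h₁ : j = k
    · subst h₁
      simp [asg]
    by_cases h₂ : j = k + 1
    · subst h₂
      simp [asg]
    · simp [asg, h₁, h₂, hj.not_gt]
  constructor
  · intro h
    obtain ⟨s⟩ : Nonempty (ℕ → M) := inferInstance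
    obtain ⟨H, hH, hopt, Y, Z, hYZ, hY, hZ, hmem⟩ := h s
    refine ⟨fun u => H (Function.update s k u), fun u => hH _ ⟨s, rfl, u, rfl⟩,
      fun u v hv => ?_, ?_⟩
    · have := hopt (asg s (fun _ => u) u v) ⟨_, ⟨_, ⟨s, rfl, u, rfl⟩, v, hv, rfl⟩,
        asg_ge s (fun _ => u) u v⟩
      simpa only [asg_u s (fun _ => u) u v, asg_v s (fun _ => u) u v] using this
    · convert hmem using 1
      ext t
      constructor
      · rintro ⟨u, v, hv, ht⟩
        have : asg s t u v ∈ Y ∪ Z := hYZ ▸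
          ⟨_, ⟨_, ⟨s, rfl, u, rfl⟩, v, hv, rfl⟩, asg_ge _ _ _ _⟩
        rcases this with h' | h'
        · have := hY _ h'
          rw [asg_lt, asg_v] at this
          exact absurd ht this
        · exact ⟨_, h', (asg_lt _ _ _ _).symm⟩
      · rintro ⟨s', hs', rfl⟩
        have : s' ∈ Y ∪ Z := Or.inr hs'
        rw [← hYZ] at this
        obtain ⟨_, ⟨_, ⟨_, rfl, u, rfl⟩, v, hv, rfl⟩, hj⟩ := this
        refine ⟨u, v, hv, ?_⟩
        have := hZ _ hs'
        rwa [hj (k + 1) (by omega), Function.update_self] at this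
  · rintro ⟨H, hH, hopt, hmem⟩ s
    refine ⟨fun s' => H (s' k), fun s' _ => hH _, ?_, ?_⟩
    · rintro s' ⟨_, ⟨_, ⟨_, rfl, u, rfl⟩, v, hv, rfl⟩, hj⟩
      rw [hj k le_rfl, hj (k + 1) (by omega)]
      simpa using hopt u v (by simpa using hv)
    · refine ⟨_, _, (Set.union_comm _ _).trans (Set.inter_union_compl _
        {s' : ℕ → M | (fun j : Fin k => s' j) ∈ O (s' (k + 1))}) |>.symm, fun s' hs' => hs'.2,
        fun s' hs' => hs'.2, ?_⟩
      convert hmem using 1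
      ext t
      constructor
      · rintro ⟨s', ⟨⟨_, ⟨_, ⟨_, rfl, u, rfl⟩, v, hv, rfl⟩, hj⟩, hs'⟩, rfl⟩
        rw [Set.mem_ofPred_eq, hj (k + 1) (by omega), Function.update_self] at hs'
        exact ⟨u, v, by simpa using hv, hs'⟩
      · rintro ⟨u, v, hv, ht⟩
        refine ⟨asg s t u v, ⟨⟨_, ⟨_, ⟨s, rfl, u, rfl⟩, v, ?_, rfl⟩, asg_ge _ _ _ _⟩, ?_⟩,
          (asg_lt _ _ _ _).symm⟩
        · simpa using hv
        · rwa [Set.mem_ofPred_eq, asg_lt, asg_v]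

end Selection

/-! ### Ultraproducts -/

section Ultraproduct

open Filter

variable {k : ℕ} {D : Dependency k} {α : Type} {M : α → Type} (U : Ultrafilter α)

/-- The element of the ultraproduct represented by `f`. -/
def ultraMk (f : ∀ i, M i) : (U : Filter α).Product M :=
  @Quotient.mk' _ ((U : Filter α).productSetoid M) f

variable {U} in
theorem ultraMk_eq_iff {f g : ∀ i, M i} : ultraMk U f = ultraMk U g ↔ ∀ᶠ i in U, f i = g i :=
  @Quotient.eq' _ ((U : Filter α).productSetoid M) f g

theorem ultraMk_surjective : Function.Surjective (ultraMk U (M := M)) :=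
  @Quotient.mk'_surjective _ ((U : Filter α).productSetoid M)

/-- The tuple of elements of the ultraproduct represented by `r`. -/
def ultraTuple (r : ∀ i, Fin k → M i) (j : Fin k) : (U : Filter α).Product M :=
  ultraMk U fun i => r i j

theorem ultraTuple_surjective : Function.Surjective (ultraTuple U (M := M) (k := k)) := by
  intro t
  choose f hf using fun j => ultraMk_surjective U (t j)
  exact ⟨fun i j => f j i, funext hf⟩

variable {U} in
theorem ultraTuple_eq_iff {r r' : ∀ i, Fin k → M i} :
    ultraTuple U r = ultraTuple U r' ↔ ∀ᶠ i in U, r i = r' i := by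
  simp only [funext_iff, eventually_all]
  exact forall_congr' fun j => ultraMk_eq_iff

/-- The ultraproduct of a family of relations. -/
def ultraRel (R : ∀ i, Set (Fin k → M i)) : Set (Fin k → (U : Filter α).Product M) :=
  {t | ∃ r, t = ultraTuple U r ∧ ∀ᶠ i in U, r i ∈ R i}

variable {U} in
theorem ultraTuple_mem_iff {R : ∀ i, Set (Fin k → M i)} {r : ∀ i, Fin k → M i} :
    ultraTuple U r ∈ ultraRel U R ↔ ∀ᶠ i in U, r i ∈ R i := by
  refine ⟨?_, fun h => ⟨r, rfl, h⟩⟩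
  rintro ⟨r', h, h'⟩
  filter_upwards [ultraTuple_eq_iff.1 h, h'] with i h₁ h₂
  rwa [h₁]

theorem ultraRel_mono {R S : ∀ i, Set (Fin k → M i)} (h : ∀ᶠ i in U, R i ⊆ S i) :
    ultraRel U R ⊆ ultraRel U S := by
  rintro _ ⟨r, rfl, hr⟩
  exact ⟨r, rfl, by filter_upwards [h, hr] with i h₁ h₂ using h₁ h₂⟩

/-- The ultraproduct of a family of binary relations. -/
def ultraOpt (Opt : ∀ i, M i → M i → Prop) (x y : (U : Filter α).Product M) : Prop :=
  ∃ f g, x = ultraMk U f ∧ y = ultraMk U g ∧ ∀ᶠ i in U, Opt i (f i) (g i)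

variable {U} in
theorem ultraOpt_iff {Opt : ∀ i, M i → M i → Prop} {f g : ∀ i, M i} :
    ultraOpt U Opt (ultraMk U f) (ultraMk U g) ↔ ∀ᶠ i in U, Opt i (f i) (g i) := by
  refine ⟨?_, fun h => ⟨f, g, rfl, rfl, h⟩⟩
  rintro ⟨f', g', h, h', h''⟩
  filter_upwards [ultraMk_eq_iff.1 h, ultraMk_eq_iff.1 h', h''] with i h₁ h₂ h₃
  rwa [h₁, h₂]

/-- The ultraproduct of a family of functions to relations. -/
def ultraOption (O : ∀ i, M i → Set (Fin k → M i)) (v : (U : Filter α).Product M) :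
    Set (Fin k → (U : Filter α).Product M) :=
  {t | ∃ f, v = ultraMk U f ∧ t ∈ ultraRel U fun i => O i (f i)}

variable {U} in
theorem ultraOption_mk {O : ∀ i, M i → Set (Fin k → M i)} {f : ∀ i, M i} :
    ultraOption U O (ultraMk U f) = ultraRel U fun i => O i (f i) := by
  refine Set.Subset.antisymm ?_ fun t h => ⟨f, rfl, h⟩
  rintro t ⟨f', h, h'⟩
  refine ultraRel_mono U ?_ h'
  filter_upwards [ultraMk_eq_iff.1 h] with i h
  rw [h]

theorem exists_ultrafilter_finset (A : Type) :
    ∃ U : Ultrafilter (Finset A), ∀ x, ∀ᶠ F : Finset A in U, x ∈ F := by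
  classical
  refine ⟨Ultrafilter.of atTop, fun x => ?_⟩
  have h := Ultrafilter.of_le (atTop : Filter (Finset A)) (eventually_ge_atTop {x})
  filter_upwards [h] with F hF using Finset.singleton_subset_iff.1 hF

variable [∀ i, Nonempty (M i)]

instance : Nonempty ((U : Filter α).Product M) :=
  ⟨ultraMk U fun _ => Classical.arbitrary _⟩

variable {U}

theorem StronglyFirstOrder.selectable_ultraproduct_iff (hD : StronglyFirstOrder D)
    {Opt : ∀ i, M i → M i → Prop} {O : ∀ i, M i → Set (Fin k → M i)} :
    D.Selectable (ultraOpt U Opt) (ultraOption U O) ↔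
      ∀ᶠ i in U, D.Selectable (Opt i) (O i) := by
  obtain ⟨ψ, hψ⟩ := hD _ (selectionFormula D) (freeVars_selectionFormula D)
  let inst : ∀ i, (selectionLanguage k).Structure (M i) := fun i => selectionStructure (Opt i) (O i)
  have h₁ : ∀ i, D.Selectable (Opt i) (O i) ↔ M i ⊨ ψ := fun i => by
    rw [← trueIn_selectionFormula (Opt := Opt i) (O := O i) D (M i) (fun _ => Iff.rfl)
      (fun _ => Iff.rfl)]
    exact hψ (M i)
  have h₂ : D.Selectable (ultraOpt U Opt) (ultraOption U O) ↔ (U : Filter α).Product M ⊨ ψ := by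
    rw [← trueIn_selectionFormula (Opt := ultraOpt U Opt) (O := ultraOption U O) D
      ((U : Filter α).Product M) (fun x => ?_) (fun x => ?_)]
    · exact hψ _
    · obtain ⟨r, rfl⟩ := ultraTuple_surjective U x
      refine (relMap_quotient_mk' (L := selectionLanguage k)
        (s := (U : Filter α).productSetoid M) SelectionRel.opt fun j i => r i j).trans ?_
      exact ultraOpt_iff.symm
    · obtain ⟨r, rfl⟩ := ultraTuple_surjective U x
      refine (relMap_quotient_mk' (L := selectionLanguage k)
        (s := (U : Filter α).productSetoid M) SelectionRel.option fun j i => r i j).trans ?_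
      refine Iff.trans ?_ (Set.ext_iff.1 ultraOption_mk.symm _)
      exact ultraTuple_mem_iff.symm
  simp only [h₁, h₂]
  exact Ultraproduct.sentence_realize ψ

theorem Dependency.selectable_const_iff {A : Type} [Nonempty A] {R : Set (Fin k → A)} :
    D.Selectable (fun _ _ => True) (fun _ => R) ↔ D.Mem A R := by
  constructor
  · rintro ⟨H, h, -, h'⟩
    convert h' using 1
    ext t
    obtain ⟨u⟩ := ‹Nonempty A›
    obtain ⟨v, hv⟩ := h u
    exact ⟨fun ht => ⟨u, v, hv, ht⟩, fun ⟨_, _, _, ht⟩ => ht⟩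
  · refine fun h => ⟨fun _ => Set.univ, fun u => Set.univ_nonempty, fun _ _ _ => trivial, ?_⟩
    convert h using 1
    ext t
    simp

theorem StronglyFirstOrder.mem_ultraRel_iff (hD : StronglyFirstOrder D)
    {R : ∀ i, Set (Fin k → M i)} :
    D.Mem ((U : Filter α).Product M) (ultraRel U R) ↔ ∀ᶠ i in U, D.Mem (M i) (R i) := by
  simp only [← Dependency.selectable_const_iff]
  rw [← hD.selectable_ultraproduct_iff]
  apply iff_of_eq
  congr 1
  · ext x y
    obtain ⟨f, rfl⟩ := ultraMk_surjective U x
    obtain ⟨g, rfl⟩ := ultraMk_surjective U y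
    rw [ultraOpt_iff]
    simp
  · ext1 x
    obtain ⟨f, rfl⟩ := ultraMk_surjective U x
    rw [ultraOption_mk]

end Ultraproduct

/-! ### Relations matching no valid pattern -/

section Pattern

open Filter

variable {k : ℕ} {D : Dependency k} {A B : Type} {R : Set (Fin k → A)}

/-- A pattern is valid for `D` if all relations that match it satisfy `D`. -/
def Pattern.Valid (D : Dependency k) (p : Pattern k) : Prop :=
  ∀ (A : Type) [Nonempty A] (R : Set (Fin k → A)), (∃ a, p.MatchAt R a) → D.Mem A R

/-- The relation `R` matches `p` with parameters from its field. -/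
def Pattern.FldMatch (p : Pattern k) (R : Set (Fin k → A)) : Prop :=
  ∃ a, p.MatchAt R a ∧ ∀ l, a l ∈ Fld R

/-- A relation is bad if it satisfies `D` without matching any pattern that is valid for `D`. -/
def Dependency.Bad (D : Dependency k) (R : Set (Fin k → A)) : Prop :=
  D.Mem A R ∧ ∀ p : Pattern k, p.Valid D → ¬ p.FldMatch R

theorem Pattern.FldMatch.of_image {p : Pattern k} {h : A → B} (hh : Set.InjOn h (Fld R))
    (hp : p.FldMatch ((h ∘ ·) '' R)) : p.FldMatch R := by
  obtain ⟨a', ⟨hinj, htypes, hbase⟩, ha'⟩ := hp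
  rw [fld_image] at ha'
  choose a ha haa' using ha'
  obtain rfl : h ∘ a = a' := funext haa'
  refine ⟨a, ⟨hinj.of_comp, fun t ht => ?_, fun u hu => ?_⟩, ha⟩
  · convert htypes _ ⟨t, ht, rfl⟩ using 1
    ext i j
    · exact (hh.eq_iff (mem_fld ht i) (mem_fld ht j)).symm
    · exact (hh.eq_iff (mem_fld ht i) (ha j)).symm
  · obtain ⟨t, ht, h'⟩ := hbase u hu
    convert ht
    ext i
    exact hh (ha _) (mem_fld ht i) (congrFun h' i).symm

theorem Dependency.Bad.image (hD : D.DomainIndependent) {h : A → B} (hh : Set.InjOn h (Fld R))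
    (hR : D.Bad R) : D.Bad ((h ∘ ·) '' R) :=
  ⟨(hD.mem_image_iff hh).2 hR.1, fun p hp h' => hR.2 p hp (h'.of_image hh)⟩

section Ultraproduct

variable {α : Type} {M : α → Type} {U : Ultrafilter α}

theorem Ultrafilter.eventually_iff_eventually (U : Ultrafilter α) (P : α → Prop) :
    ∀ᶠ i in U, (P i ↔ ∀ᶠ j in U, P j) := by
  by_cases h : ∀ᶠ j in U, P j
  · filter_upwards [h] with i hi
    exact iff_of_true hi h
  · filter_upwards [Ultrafilter.eventually_not.2 h] with i hi
    exact iff_of_false hi h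

theorem eventually_eqType_eq {m : ℕ} (t : ∀ i, Fin k → M i) (a : ∀ i, Fin m → M i) :
    ∀ᶠ i in U, eqType (t i) (a i) = eqType (ultraTuple U t) (ultraTuple U a) := by
  have h₁ : ∀ᶠ i in U, ∀ j j' : Fin k, t i j = t i j' ↔ ∀ᶠ i in U, t i j = t i j' :=
    eventually_all.2 fun j => eventually_all.2 fun j' => U.eventually_iff_eventually _
  have h₂ : ∀ᶠ i in U, ∀ (j : Fin k) (l : Fin m), t i j = a i l ↔ ∀ᶠ i in U, t i j = a i l :=
    eventually_all.2 fun j => eventually_all.2 fun j' => U.eventually_iff_eventually _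
  filter_upwards [h₁, h₂] with i h₁ h₂
  ext j l
  · exact (h₁ j l).trans ultraMk_eq_iff.symm
  · exact (h₂ j l).trans ultraMk_eq_iff.symm

theorem Pattern.FldMatch.eventually [∀ i, Nonempty (M i)] {p : Pattern k}
    {R : ∀ i, Set (Fin k → M i)} (h : p.FldMatch (ultraRel U R)) :
    ∀ᶠ i in U, p.FldMatch (R i) := by
  obtain ⟨a, ⟨hinj, htypes, hbase⟩, ha⟩ := h
  obtain ⟨r, rfl⟩ := ultraTuple_surjective U a
  have hinj' : ∀ᶠ i in U, ∀ l l', r i l = r i l' → l = l' := by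
    refine eventually_all.2 fun l => eventually_all.2 fun l' => ?_
    by_cases hl : l = l'
    · exact Eventually.of_forall fun _ _ => hl
    · filter_upwards [Ultrafilter.eventually_not.2 fun h => hl (hinj (ultraMk_eq_iff.2 h))]
        with i hi h using absurd h hi
  have hbase' : ∀ᶠ i in U, ∀ u ∈ p.base, r i ∘ u ∈ R i := by
    refine eventually_all.2 fun u => ?_
    by_cases hu : u ∈ p.base
    · filter_upwards [ultraTuple_mem_iff (r := fun i => r i ∘ u).1 (hbase u hu)] with i hi _
      exact hi
    · exact Eventually.of_forall fun _ h => absurd h hu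
  have ha' : ∀ᶠ i in U, ∀ l, r i l ∈ Fld (R i) := by
    refine eventually_all.2 fun l => ?_
    obtain ⟨_, ⟨t, rfl, ht⟩, j, hj⟩ := ha l
    filter_upwards [ht, ultraMk_eq_iff.1 hj] with i h₁ h₂
    exact ⟨t i, h₁, j, h₂⟩
  have htypes' : ∀ᶠ i in U, ∀ t ∈ R i, eqType t (r i) ∈ p.types := by
    by_contra hcon
    have hcon : ∀ᶠ i in U, ∃ t ∈ R i, eqType t (r i) ∉ p.types := by
      filter_upwards [Ultrafilter.eventually_not.2 hcon] with i hi
      push Not at hi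
      exact hi
    have : ∀ i, ∃ t, (∃ t ∈ R i, eqType t (r i) ∉ p.types) → t ∈ R i ∧ eqType t (r i) ∉ p.types := by
      intro i
      by_cases h : ∃ t ∈ R i, eqType t (r i) ∉ p.types
      · exact h.imp fun t ht _ => ht
      · exact ⟨fun _ => Classical.arbitrary _, fun h' => absurd h' h⟩
    choose t ht using this
    have hmem := htypes (ultraTuple U t)
      (ultraTuple_mem_iff.2 (hcon.mono fun i hi => (ht i hi).1))
    obtain ⟨i, h₁, h₂⟩ := ((eventually_eqType_eq (U := U) t r).and hcon).exists
    exact (ht i h₂).2 (h₁ ▸ hmem)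
  filter_upwards [hinj', hbase', ha', htypes'] with i h₁ h₂ h₃ h₄
  exact ⟨r i, ⟨fun l l' => h₁ l l', h₄, h₂⟩, h₃⟩

theorem Dependency.Bad.ultraproduct [∀ i, Nonempty (M i)] (hD : StronglyFirstOrder D)
    {R : ∀ i, Set (Fin k → M i)} (hR : ∀ i, D.Bad (R i)) : D.Bad (ultraRel U R) := by
  refine ⟨hD.mem_ultraRel_iff.2 (Eventually.of_forall fun i => (hR i).1), fun p hp h => ?_⟩
  obtain ⟨i, hi⟩ := h.eventually.exists
  exact (hR i).2 p hp hi

end Ultraproduct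

theorem StronglyFirstOrder.patternDefinable (hD : StronglyFirstOrder D)
    (hbad : ∀ (A : Type) [Nonempty A] (R : Set (Fin k → A)), ¬ D.Bad R) :
    D.PatternDefinable := by
  classical
  by_contra hcon
  have : ∀ P : Finset {p : Pattern k // p.Valid D}, ∃ (A : Type) (_ : Nonempty A)
      (R : Set (Fin k → A)), D.Mem A R ∧ ∀ p ∈ P, ¬ p.1.FldMatch R := by
    intro P
    by_contra h
    push Not at h
    refine hcon ⟨P.image Subtype.val, fun A _ R => ⟨fun hR => ?_, ?_⟩⟩
    · obtain ⟨p, hp, a, ha, -⟩ := h A inferInstance R hR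
      exact ⟨p, Finset.mem_image_of_mem _ hp, a, ha⟩
    · rintro ⟨p, hp, h⟩
      obtain ⟨p, -, rfl⟩ := Finset.mem_image.1 hp
      exact p.2 A R h
  choose A _ R hR hP using this
  obtain ⟨U, hU⟩ := exists_ultrafilter_finset {p : Pattern k // p.Valid D}
  refine hbad _ (ultraRel U R) ⟨hD.mem_ultraRel_iff.2 (Eventually.of_forall hR), fun p hp h => ?_⟩
  obtain ⟨P, h₁, h₂⟩ := ((hU ⟨p, hp⟩).and h.eventually).exists
  exact hP P ⟨p, hp⟩ h₁ h₂

/-- The tuple `t` is indistinguishable from tuples of `R` by finitely many elements of its field. -/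
def Near (R : Set (Fin k → A)) (t : Fin k → A) : Prop :=
  ∀ F : Set A, F.Finite → F ⊆ Fld R → ∃ t' ∈ R, (∀ i j, t i = t j ↔ t' i = t' j) ∧
    ∀ a ∈ F, ∀ i, t i = a ↔ t' i = a

theorem Dependency.Bad.exists_near (hD : StronglyFirstOrder D) (hDI : D.DomainIndependent)
    (hR : D.Bad R) : ∃ (B : Type) (_ : Nonempty B) (h : A → B) (S : Set (Fin k → B)),
      Set.InjOn h (Fld R) ∧ (h ∘ ·) '' R ⊆ S ∧ ¬ D.Mem B S ∧
        ∀ t ∈ S, Near ((h ∘ ·) '' R) t := by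
  classical
  have : ∀ F : Finset A, ∃ (B : Type) (g : A → Option B) (S : Set (Fin k → B)), ¬ D.Mem B S ∧
      (∀ x ∈ F, x ∈ Fld R → g x ≠ none) ∧
      (∀ x ∈ F, x ∈ Fld R → ∀ y ∈ F, y ∈ Fld R → g x = g y → x = y) ∧
      (∀ t ∈ R, (∀ i, t i ∈ F) → ∃ s ∈ S, some ∘ s = g ∘ t) ∧
      ∀ s ∈ S, ∃ t ∈ R, (∀ i j, s i = s j ↔ t i = t j) ∧
        ∀ i, ∀ x ∈ F, x ∈ Fld R → (some (s i) = g x ↔ t i = x) := by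
    intro F
    let F' : Finset A := F.filter (· ∈ Fld R)
    let e : F' ≃ Fin F'.card := F'.equivFin
    let a : Fin F'.card → A := fun l => (e.symm l : A)
    have ha : Function.Injective a := Subtype.val_injective.comp e.symm.injective
    let p : Pattern k := ⟨F'.card, {τ | ∃ t ∈ R, eqType t a = τ}, {u | a ∘ u ∈ R}⟩
    have hp : ¬ p.Valid D := fun h => hR.2 p h
      ⟨a, ⟨ha, fun t ht => ⟨t, ht, rfl⟩, fun u hu => hu⟩,
        fun l => (Finset.mem_filter.1 (e.symm l).2).2⟩
    simp only [Pattern.Valid, not_forall] at hp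
    obtain ⟨B, _, S, ⟨b, hb, htypes, hbase⟩, hS⟩ := hp
    let g : A → Option B := fun x => if h : x ∈ F' then some (b (e ⟨x, h⟩)) else none
    have hg : ∀ x ∈ F, x ∈ Fld R → ∃ l, a l = x ∧ g x = some (b l) := by
      intro x hx hx'
      have hxF : x ∈ F' := Finset.mem_filter.2 ⟨hx, hx'⟩
      exact ⟨e ⟨x, hxF⟩, by simp [a], by simp only [g, dif_pos hxF]⟩
    refine ⟨B, g, S, hS, ?_, ?_, ?_, ?_⟩
    · intro x hx hx' h
      obtain ⟨l, -, h'⟩ := hg x hx hx'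
      simp [h'] at h
    · intro x hx hx' y hy hy' h
      obtain ⟨l, rfl, h₁⟩ := hg x hx hx'
      obtain ⟨l', rfl, h₂⟩ := hg y hy hy'
      rw [h₁, h₂] at h
      rw [hb (Option.some_injective _ h)]
    · intro t ht htF
      choose u hu hu' using fun i => hg (t i) (htF i) (mem_fld ht i)
      refine ⟨b ∘ u, hbase u ?_, funext fun i => (hu' i).symm⟩
      change a ∘ u ∈ R
      rwa [show a ∘ u = t from funext hu]
    · intro s hs
      obtain ⟨t, ht, h⟩ := htypes s hs
      refine ⟨t, ht, fun i j => ?_, fun i x hx hx' => ?_⟩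
      · exact (iff_of_eq (congrFun (congrFun (congrArg Prod.fst h) i) j)).symm
      · obtain ⟨l, rfl, hl⟩ := hg x hx hx'
        rw [hl, Option.some_inj]
        exact (iff_of_eq (congrFun (congrFun (congrArg Prod.snd h) i) l)).symm
  choose B g S hS _ hg hRS hSR using this
  obtain ⟨U, hU⟩ := exists_ultrafilter_finset A
  let h : A → (U : Filter (Finset A)).Product fun F => Option (B F) := fun x =>
    ultraMk U fun F => g F x
  have hinj : Set.InjOn h (Fld R) := by
    intro x hx y hy hxy
    obtain ⟨F, hF, hxF, hyF⟩ := ((ultraMk_eq_iff.1 hxy).and ((hU x).and (hU y))).exists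
    exact hg F x hxF hx y hyF hy hF
  refine ⟨_, inferInstance, h, ultraRel U fun F => (some ∘ ·) '' S F, hinj, ?_, ?_, ?_⟩
  · rintro _ ⟨t, ht, rfl⟩
    refine (ultraTuple_mem_iff (r := fun F => g F ∘ t)).2 ?_
    filter_upwards [eventually_all.2 fun i => hU (t i)] with F hF
    exact hRS F t ht hF
  · rw [hD.mem_ultraRel_iff, ← Ultrafilter.eventually_not]
    exact Eventually.of_forall fun F => by
      rw [hDI.mem_image_injective_iff (Option.some_injective _)]
      exact hS F
  · rintro _ ⟨r, rfl, hr⟩ F₀ hF₀ hF₀'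
    rw [fld_image] at hF₀'
    have : ∀ y : F₀, ∃ x ∈ Fld R, h x = y := fun y => hF₀' y.2
    choose c hc hcy using this
    have := hF₀.to_subtype
    have h₁ : ∀ᶠ F : Finset A in U, ∀ y, c y ∈ F := eventually_all.2 fun y => hU _
    have h₂ : ∀ᶠ F in U, ∀ y i, r F i = g F (c y) ↔ ∀ᶠ F in U, r F i = g F (c y) :=
      eventually_all.2 fun y => eventually_all.2 fun i => U.eventually_iff_eventually _
    have h₃ : ∀ᶠ F in U, ∀ i j, r F i = r F j ↔ ∀ᶠ F in U, r F i = r F j :=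
      eventually_all.2 fun y => eventually_all.2 fun i => U.eventually_iff_eventually _
    obtain ⟨F, h₁, h₂, h₃, s, hs, hsr⟩ := (h₁.and (h₂.and (h₃.and hr))).exists
    obtain ⟨t, ht, ht₁, ht₂⟩ := hSR F s hs
    have hsr : ∀ i, r F i = some (s i) := fun i => (congrFun hsr i).symm
    refine ⟨h ∘ t, ⟨t, ht, rfl⟩, fun i j => ?_, fun y hy i => ?_⟩
    · refine (ultraMk_eq_iff.trans (h₃ i j).symm).trans ?_
      rw [hsr, hsr, Option.some_inj, ht₁]
      exact (hinj.eq_iff (mem_fld ht i) (mem_fld ht j)).symm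
    · obtain ⟨x, hx, hxy⟩ : ∃ x, c ⟨y, hy⟩ = x ∧ h x = y := ⟨_, rfl, hcy ⟨y, hy⟩⟩
      have hxF := h₁ ⟨y, hy⟩
      have hxR := hc ⟨y, hy⟩
      have h₂ := h₂ ⟨y, hy⟩ i
      rw [hx] at hxF hxR h₂
      rw [← hxy]
      refine (ultraMk_eq_iff.trans h₂.symm).trans ?_
      rw [hsr, ht₂ i x hxF hxR]
      exact (hinj.eq_iff (mem_fld ht i) hxR).symm

end Pattern

/-! ### Upwards closed and union closed dependencies -/

section Union

open Filter

variable {k : ℕ} {D : Dependency k} {A B : Type} {R : Set (Fin k → A)}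

theorem image_comp_tuple {C : Type} (g : B → C) (f : A → B) (R : Set (Fin k → A)) :
    ((g ∘ f) ∘ ·) '' R = (g ∘ ·) '' ((f ∘ ·) '' R) := by
  rw [Set.image_image]
  rfl

theorem Dependency.UpwardsClosed.not_bad (hU : D.UpwardsClosed) (hD : StronglyFirstOrder D)
    (hDI : D.DomainIndependent) (R : Set (Fin k → A)) : ¬ D.Bad R := by
  intro hR
  obtain ⟨B, _, h, S, hh, hRS, hS, -⟩ := hR.exists_near hD hDI
  exact hS (hU _ _ _ (hR.image hDI hh).1 hRS)

theorem Near.exists_extension [Nonempty A] (hD : StronglyFirstOrder D)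
    (hDI : D.DomainIndependent) {t : Fin k → A} (ht : Near R t) :
    ∃ (B : Type) (_ : Nonempty B) (f : A → B) (R₁ : Set (Fin k → B)) (t₁ : Fin k → B),
      Function.Injective f ∧ t₁ ∈ R₁ ∧ (f ∘ ·) '' R ⊆ R₁ ∧ (D.Mem A R → D.Mem B R₁) ∧
      (D.Bad R → D.Bad R₁) ∧ (D.Mem B (insert t₁ ((f ∘ ·) '' R)) ↔ D.Mem A (insert t R)) := by
  classical
  obtain ⟨U, hU⟩ := exists_ultrafilter_finset A
  choose r hrR hr hrF using fun F : Finset A =>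
    ht (F ∩ Fld R) (F.finite_toSet.inter_of_left _) Set.inter_subset_right
  let f : A → (U : Filter (Finset A)).Product fun _ => A := fun x => ultraMk U fun _ => x
  have hf : Function.Injective f := fun x y hxy => by
    obtain ⟨-, h⟩ := (ultraMk_eq_iff.1 hxy).exists
    exact h
  let t₁ := ultraTuple U r
  have h₁ : ∀ i j, t₁ i = t₁ j ↔ t i = t j := fun i j => by
    refine ultraMk_eq_iff.trans ?_
    simp only [← hr, eventually_const]
  have h₂ : ∀ i, ∀ x ∈ Fld R, t₁ i = f x ↔ t i = x := fun i x hx => by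
    refine ultraMk_eq_iff.trans ?_
    rw [← eventually_const (f := (U : Filter (Finset A))) (p := t i = x)]
    apply eventually_congr
    filter_upwards [hU x] with F hF using (hrF F x ⟨hF, hx⟩ i).symm
  refine ⟨_, inferInstance, f, ultraRel U fun _ => R, t₁, hf,
    ultraTuple_mem_iff.2 (Eventually.of_forall hrR), ?_, fun h =>
      hD.mem_ultraRel_iff.2 (Eventually.of_forall fun _ => h),
    fun h => Dependency.Bad.ultraproduct hD fun _ => h, ?_⟩
  · rintro _ ⟨s, hs, rfl⟩
    exact (ultraTuple_mem_iff (r := fun _ => s)).2 (Eventually.of_forall fun _ => hs)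
  · let h : A → (U : Filter (Finset A)).Product fun _ => A := fun x =>
      if hx : x ∉ Fld R ∧ ∃ i, t i = x then t₁ hx.2.choose else f x
    have hR : ∀ x ∈ Fld R, h x = f x := fun x hx => dif_neg fun h => h.1 hx
    have ht : ∀ i, h (t i) = t₁ i := by
      intro i
      by_cases hi : t i ∈ Fld R
      · rw [hR _ hi]
        exact ((h₂ i _ hi).2 rfl).symm
      · have hx : t i ∉ Fld R ∧ ∃ j, t j = t i := ⟨hi, i, rfl⟩
        simp only [h, dif_pos hx]
        exact (h₁ _ _).2 hx.2.choose_spec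
    have hinj : Set.InjOn h (Fld (insert t R)) := by
      have aux : ∀ x ∈ Fld (insert t R), x ∈ Fld R ∨ ∃ i, t i = x := by
        rintro _ ⟨s, rfl | hs, i, rfl⟩
        · exact Or.inr ⟨i, rfl⟩
        · exact Or.inl ⟨s, hs, i, rfl⟩
      intro x hx y hy hxy
      rcases aux x hx with hx | ⟨i, rfl⟩ <;> rcases aux y hy with hy | ⟨j, rfl⟩
      · rw [hR x hx, hR y hy] at hxy
        exact hf hxy
      · rw [hR x hx, ht] at hxy
        exact ((h₂ j x hx).1 hxy.symm).symm
      · rw [hR y hy, ht] at hxy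
        exact (h₂ i y hy).1 hxy
      · rw [ht, ht] at hxy
        exact (h₁ i j).1 hxy
    rw [← hDI.mem_image_iff hinj, Set.image_insert_eq, show h ∘ t = t₁ from funext ht]
    apply iff_of_eq
    congr 2
    refine Set.image_congr fun s hs => funext fun i => (hR _ (mem_fld hs i)).symm

variable (hU : D.UnionClosed) (hD : StronglyFirstOrder D) (hDI : D.DomainIndependent)

include hU hD hDI

theorem Dependency.UnionClosed.exists_bad_extension (hR : D.Bad R) :
    ∃ (B : Type) (_ : Nonempty B) (f : A → B) (R₁ : Set (Fin k → B)) (t : Fin k → B),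
      Set.InjOn f (Fld R) ∧ D.Bad R₁ ∧ (f ∘ ·) '' R ⊆ R₁ ∧ t ∈ R₁ ∧
        ¬ D.Mem B (insert t ((f ∘ ·) '' R)) := by
  obtain ⟨B, _, h, S, hh, hRS, hS, hnear⟩ := hR.exists_near hD hDI
  obtain ⟨t, ht, htS⟩ : ∃ t ∈ S, ¬ D.Mem B (insert t ((h ∘ ·) '' R)) := by
    by_contra! hcon
    apply hS
    convert hU B (ULift S) (fun t => insert t.down.1 ((h ∘ ·) '' R)) fun t => hcon _ t.down.2
    refine Set.Subset.antisymm (fun t ht => Set.mem_iUnion.2 ⟨⟨t, ht⟩, Set.mem_insert _ _⟩) ?_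
    exact Set.iUnion_subset fun t => Set.insert_subset t.down.2 hRS
  obtain ⟨C, hC, f, R₁, t₁, hf, h₁, h₂, -, h₃, h₄⟩ := (hnear t ht).exists_extension hD hDI
  refine ⟨C, hC, f ∘ h, R₁, t₁, hf.comp_injOn hh, h₃ (hR.image hDI hh), ?_, h₁, ?_⟩
  · rwa [image_comp_tuple]
  · rwa [image_comp_tuple, h₄]

theorem Dependency.UnionClosed.exists_bad_chain [Nonempty A] (hR : D.Bad R) (n : ℕ) :
    ∃ (B : Type) (_ : Nonempty B) (R : ℕ → Set (Fin k → B)) (t : ℕ → Fin k → B),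
      Monotone R ∧ (∀ i, D.Bad (R i)) ∧
        ∀ i < n, t i ∈ R (i + 1) ∧ ¬ D.Mem B (insert (t i) (R i)) := by
  induction n with
  | zero =>
    exact ⟨A, inferInstance, fun _ => R, fun _ _ => Classical.arbitrary A, monotone_const,
      fun _ => hR, fun i hi => absurd hi i.not_lt_zero⟩
  | succ n ih =>
    obtain ⟨B, _, R, t, hmono, hbad, hRt⟩ := ih
    obtain ⟨C, hC, f, R₁, t₁, hf, h₁, h₂, h₃, h₄⟩ :=
      hU.exists_bad_extension hD hDI (hbad n)
    refine ⟨C, hC, fun i => if i ≤ n then (f ∘ ·) '' R i else R₁,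
      fun i => if i < n then f ∘ t i else t₁, monotone_nat_of_le_succ fun i => ?_, fun i => ?_,
      fun i hi => ?_⟩
    · rcases lt_trichotomy i n with hi | rfl | hi
      · rw [if_pos hi.le, if_pos (show i + 1 ≤ n from hi)]
        exact Set.image_mono (hmono i.le_succ)
      · rw [if_pos le_rfl, if_neg (by omega)]
        exact h₂
      · rw [if_neg (by omega), if_neg (by omega)]
    · beta_reduce
      split_ifs with hi
      · exact (hbad i).image hDI (hf.mono (fld_mono (hmono hi)))
      · exact h₁
    · beta_reduce
      rcases Nat.lt_succ_iff_lt_or_eq.1 hi with hi | rfl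
      · rw [if_pos hi, if_pos (show i + 1 ≤ n from hi), if_pos hi.le]
        refine ⟨⟨_, (hRt i hi).1, rfl⟩, ?_⟩
        have := Set.image_insert_eq (f := (f ∘ ·)) (a := t i) (s := R i)
        rw [← this, hDI.mem_image_iff]
        · exact (hRt i hi).2
        · refine hf.mono (fld_mono (Set.insert_subset ?_ (hmono hi.le)))
          exact hmono (show i + 1 ≤ n from hi) (hRt i hi).1
      · rw [if_neg (lt_irrefl _), if_pos le_rfl, if_neg (by omega)]
        exact ⟨h₃, h₄⟩

theorem Dependency.UnionClosed.not_bad [Nonempty A] (R : Set (Fin k → A)) : ¬ D.Bad R := by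
  intro hR
  choose B _ R t hmono hbad hRt using hU.exists_bad_chain hD hDI hR
  let O : ∀ n, B n ⊕ ℕ → Set (Fin k → B n ⊕ ℕ) := fun n =>
    Sum.elim (fun _ => ∅) fun p => (Sum.inl ∘ ·) '' insert (t n p) (R n p)
  let Opt : ∀ n, B n ⊕ ℕ → B n ⊕ ℕ → Prop := fun n _ v => ∃ p < n, v = Sum.inr p
  have hnot : ∀ n, ¬ D.Selectable (Opt n) (O n) := by
    rintro n ⟨H, hH, hOpt, hmem⟩
    let P : Set ℕ := {p | ∃ u, Sum.inr p ∈ H u}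
    have hP : ∀ p ∈ P, p < n := by
      rintro p ⟨u, hu⟩
      obtain ⟨q, hq, h⟩ := hOpt u _ hu
      rwa [Sum.inr_injective h]
    have hP' : P.Nonempty := by
      obtain ⟨v, hv⟩ := hH (Sum.inr 0)
      obtain ⟨p, -, rfl⟩ := hOpt _ _ hv
      exact ⟨p, _, hv⟩
    have hbdd : BddAbove P := ⟨n, fun p hp => (hP p hp).le⟩
    have hq := Nat.sSup_mem hP' hbdd
    set q := sSup P
    refine (hRt n q (hP q hq)).2 ?_
    rw [← hDI.mem_image_injective_iff (Sum.inl_injective (β := ℕ))]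
    convert hmem using 1
    ext s
    constructor
    · intro hs
      obtain ⟨u, hu⟩ := hq
      exact ⟨u, _, hu, hs⟩
    · rintro ⟨u, v, hv, hs⟩
      obtain ⟨p, hp, rfl⟩ := hOpt _ _ hv
      have hpq : p ≤ q := le_csSup hbdd ⟨u, hv⟩
      rcases hpq.eq_or_lt with h | hpq
      · rwa [← h]
      · refine Set.image_mono ?_ hs
        refine (Set.insert_subset ?_ (hmono n hpq.le)).trans (Set.subset_insert _ _)
        exact hmono n (show p + 1 ≤ q from hpq) (hRt n p hp).1
  let U : Ultrafilter ℕ := hyperfilter ℕ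
  have hlt : ∀ p, ∀ᶠ n : ℕ in U, p < n := fun p =>
    Nat.hyperfilter_le_atTop (eventually_gt_atTop p)
  have hsel : D.Selectable (ultraOpt U Opt) (ultraOption U O) := by
    refine ⟨fun _ => Set.range fun p => ultraMk U fun n => Sum.inr p,
      fun _ => Set.range_nonempty _, ?_, ?_⟩
    · rintro u _ ⟨p, rfl⟩
      obtain ⟨u, rfl⟩ := ultraMk_surjective U u
      rw [ultraOpt_iff]
      filter_upwards [hlt p] with n hn using ⟨p, hn, rfl⟩
    · have := hU ((U : Filter ℕ).Product fun n => B n ⊕ ℕ) ℕ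
        (fun p => ultraRel U fun n => (Sum.inl ∘ ·) '' R n p) fun p => by
          rw [hD.mem_ultraRel_iff]
          refine Eventually.of_forall fun n => ?_
          rw [hDI.mem_image_injective_iff Sum.inl_injective]
          exact (hbad n p).1
      convert this using 1
      refine Set.Subset.antisymm ?_ (Set.iUnion_subset fun p s hs => ?_)
      · rintro s ⟨-, _, ⟨p, rfl⟩, hs⟩
        rw [ultraOption_mk] at hs
        refine Set.mem_iUnion.2 ⟨p + 1, ultraRel_mono U ?_ hs⟩
        filter_upwards [hlt p] with n hn
        exact Set.image_mono (Set.insert_subset (hRt n p hn).1 (hmono n p.le_succ))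
      · refine ⟨ultraMk U fun n => Sum.inr 0, _, ⟨p, rfl⟩, ?_⟩
        rw [ultraOption_mk]
        refine ultraRel_mono U (Eventually.of_forall fun n => ?_) hs
        exact Set.image_mono (Set.subset_insert _ _)
  obtain ⟨n, hn⟩ := (hD.selectable_ultraproduct_iff.1 hsel).exists
  exact hnot n hn

end Union

/-! ### Downwards closed dependencies -/

section Downwards

open Filter

variable {k : ℕ} {D : Dependency k} {A B : Type}

section Copies

/-- The embedding of `A` into a product that depends on the index `i` only outside of the field
of `R`. -/
noncomputable def copyMap (R : Set (Fin k → A)) (i : ℕ) (a : A) : A × ℕ :=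
  open Classical in (a, if a ∈ Fld R then 0 else i)

variable {R : Set (Fin k → A)}

theorem copyMap_injective (i : ℕ) : Function.Injective (copyMap R i) :=
  fun _ _ h => congrArg Prod.fst h

theorem copyMap_eq_of_mem {a : A} (ha : a ∈ Fld R) (i j : ℕ) : copyMap R i a = copyMap R j a := by
  simp [copyMap, ha]

theorem image_copyMap_eq (i j : ℕ) : (copyMap R i ∘ ·) '' R = (copyMap R j ∘ ·) '' R :=
  Set.image_congr fun _ ht => funext fun l => copyMap_eq_of_mem (mem_fld ht l) i j

/-- The image of `R` together with, for each `i < m`, a copy of `Y i`. -/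
def copies (R : Set (Fin k → A)) (Y : ℕ → Set (Fin k → A)) (m : ℕ) : Set (Fin k → A × ℕ) :=
  (copyMap R 0 ∘ ·) '' R ∪ {t | ∃ i < m, t ∈ (copyMap R i ∘ ·) '' Y i}

variable {Y : ℕ → Set (Fin k → A)}

theorem copies_zero : copies R Y 0 = (copyMap R 0 ∘ ·) '' R := by
  simp [copies]

theorem copies_succ (m : ℕ) :
    copies R Y (m + 1) = copies R Y m ∪ (copyMap R m ∘ ·) '' Y m := by
  ext t
  simp only [copies, Nat.lt_succ_iff_lt_or_eq, Set.mem_union, Set.mem_ofPred_eq, or_assoc]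
  refine or_congr_right ?_
  constructor
  · rintro ⟨i, hi | rfl, h⟩
    · exact Or.inl ⟨i, hi, h⟩
    · exact Or.inr h
  · rintro (⟨i, hi, h⟩ | h)
    · exact ⟨i, Or.inl hi, h⟩
    · exact ⟨m, Or.inr rfl, h⟩

theorem Near.copyMap {t : Fin k → A} (ht : Near R t) (m : ℕ) :
    Near (copies R Y m) (copyMap R m ∘ t) := by
  intro F hF hF'
  obtain ⟨t', ht', h₁, h₂⟩ := ht {a | a ∈ Fld R ∧ _root_.copyMap R m a ∈ F}
    ((hF.preimage (copyMap_injective m).injOn).subset fun a ha => ha.2) fun a ha => ha.1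
  refine ⟨_root_.copyMap R m ∘ t', Or.inl ?_, fun i j => ?_, fun a ha i => ?_⟩
  · rw [image_copyMap_eq 0 m]
    exact ⟨t', ht', rfl⟩
  · exact (copyMap_injective m).eq_iff.trans ((h₁ i j).trans (copyMap_injective m).eq_iff.symm)
  · by_cases hb : ∃ b ∈ Fld R, _root_.copyMap R m b = a
    · obtain ⟨b, hb, rfl⟩ := hb
      exact (copyMap_injective m).eq_iff.trans
        ((h₂ b ⟨hb, ha⟩ i).trans (copyMap_injective m).eq_iff.symm)
    · push Not at hb
      refine iff_of_false (fun h => ?_) (hb _ (mem_fld ht' i))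
      have hti : t i ∉ Fld R := fun h' => hb _ h' h
      have haR : a.1 ∉ Fld R := h ▸ hti
      have ham : a.2 = m := by
        rw [← h]
        simp [_root_.copyMap, hti]
      obtain ⟨s, hs | ⟨j, hj, hs⟩, l, hl⟩ := hF' ha
      · obtain ⟨s, hs, rfl⟩ := hs
        exact haR (hl ▸ mem_fld hs l)
      · obtain ⟨s, hs, rfl⟩ := hs
        have : a.2 = j := by
          rw [← hl] at haR ⊢
          simp only [_root_.copyMap, Function.comp_apply] at haR ⊢
          rw [if_neg haR]
        omega

end Copies

variable (hdc : D.DownwardsClosed) (hD : StronglyFirstOrder D) (hDI : D.DomainIndependent)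

include hdc hD hDI

theorem Dependency.DownwardsClosed.mem_of_eventually [Nonempty A] {α : Type} {U : Ultrafilter α}
    {W : α → Set (Fin k → A)} (hW : ∀ i, D.Mem A (W i)) {S : Set (Fin k → A)}
    (hS : ∀ t ∈ S, ∀ᶠ i in U, t ∈ W i) : D.Mem A S := by
  let f : A → (U : Filter α).Product fun _ => A := fun x => ultraMk U fun _ => x
  have hf : Function.Injective f := fun x y hxy => by
    obtain ⟨-, h⟩ := (ultraMk_eq_iff.1 hxy).exists
    exact h
  rw [← hDI.mem_image_injective_iff hf]
  refine hdc _ _ _ (hD.mem_ultraRel_iff (U := U).2 (Eventually.of_forall hW)) ?_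
  rintro _ ⟨t, ht, rfl⟩
  exact (ultraTuple_mem_iff (r := fun _ => t)).2 (hS t ht)

theorem Dependency.DownwardsClosed.mem_copies [Nonempty A] {n : ℕ}
    (ih : ∀ (A : Type) [Nonempty A] (R : Set (Fin k → A)), D.Mem A R →
      ∀ Y : Finset (Fin k → A), Y.card ≤ n → (∀ t ∈ Y, Near R t) → D.Mem A (R ∪ Y))
    {R : Set (Fin k → A)} (hR : D.Mem A R) {Y : ℕ → Finset (Fin k → A)}
    (hY : ∀ i, (Y i).card ≤ n) (hYR : ∀ i, ∀ t ∈ Y i, Near R t) :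
    D.Mem (A × ℕ) {t | ∃ m, t ∈ copies R (fun i => Y i) m} := by
  classical
  have h : ∀ m, D.Mem (A × ℕ) (copies R (fun i => (Y i : Set (Fin k → A))) m) := by
    intro m
    induction m with
    | zero => rwa [copies_zero, hDI.mem_image_injective_iff (copyMap_injective 0)]
    | succ m h =>
      have := ih _ _ h ((Y m).image (copyMap R m ∘ ·)) (Finset.card_image_le.trans (hY m)) ?_
      · rwa [Finset.coe_image, ← copies_succ] at this
      · intro t ht
        obtain ⟨s, hs, rfl⟩ := Finset.mem_image.1 ht
        exact (hYR m s hs).copyMap m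
  refine hdc.mem_of_eventually hD hDI (U := hyperfilter ℕ) h ?_
  rintro t ⟨m, hm⟩
  filter_upwards [Nat.hyperfilter_le_atTop (eventually_ge_atTop m)] with m' hm'
  exact hm.imp_right fun ⟨i, hi, h⟩ => ⟨i, hi.trans_le hm', h⟩

theorem Dependency.DownwardsClosed.mem_union_of_two_blocks [Nonempty A] {n : ℕ}
    (ih : ∀ (A : Type) [Nonempty A] (R : Set (Fin k → A)), D.Mem A R →
      ∀ Y : Finset (Fin k → A), Y.card ≤ n → (∀ t ∈ Y, Near R t) → D.Mem A (R ∪ Y))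
    {R : Set (Fin k → A)} (hR : D.Mem A R) {Y : Bool → Finset (Fin k → A)}
    (hY : ∀ b, (Y b).card ≤ n) (hYR : ∀ b, ∀ t ∈ Y b, Near R t) :
    D.Mem A (R ∪ (Y true ∪ Y false)) := by
  by_contra hcon
  let P : ℕ → Bool → Set (Fin k → A × ℕ) := fun i b =>
    (copyMap R 0 ∘ ·) '' R ∪ (copyMap R i ∘ ·) '' (Y b : Set (Fin k → A))
  have hP : ∀ i, ∀ W, P i true ⊆ W → P i false ⊆ W → ¬ D.Mem (A × ℕ) W := by
    intro i W h₁ h₂ hW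
    refine hcon ((hDI.mem_image_injective_iff (copyMap_injective (R := R) i)).1 (hdc _ _ _ hW ?_))
    rw [Set.image_union, Set.image_union, image_copyMap_eq i 0, Set.union_subset_iff,
      Set.union_subset_iff]
    exact ⟨Set.subset_union_left.trans h₁, Set.subset_union_right.trans h₁,
      Set.subset_union_right.trans h₂⟩
  let O : (A × ℕ) ⊕ (ℕ × Bool) → Set (Fin k → (A × ℕ) ⊕ (ℕ × Bool)) :=
    Sum.elim (fun _ => ∅) fun q => (Sum.inl ∘ ·) '' P q.1 q.2
  let idx : (A × ℕ) ⊕ (ℕ × Bool) → ℕ := Sum.elim (fun _ => 0) Prod.fst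
  let Opt : ℕ → (A × ℕ) ⊕ (ℕ × Bool) → (A × ℕ) ⊕ (ℕ × Bool) → Prop := fun N u v =>
    (idx u ≤ N ∧ v = Sum.inr (idx u, true)) ∨
      (0 < idx u ∧ idx u ≤ N ∧ v = Sum.inr (idx u - 1, false)) ∨
      (N < idx u ∧ v = Sum.inr (N, false))
  have hnot : ∀ N, ¬ D.Selectable (Opt N) O := by
    rintro N ⟨H, hH, hOpt, hmem⟩
    have hne : ∀ i u u', Sum.inr (i, true) ∈ H u → Sum.inr (i, false) ∉ H u' := by
      intro i u u' hu hu'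
      refine hP i _ Set.subset_union_left Set.subset_union_right
        ((hDI.mem_image_injective_iff (Sum.inl_injective (β := ℕ × Bool))).1 (hdc _ _ _ hmem ?_))
      rw [Set.image_union]
      exact Set.union_subset (fun t ht => ⟨u, _, hu, ht⟩) fun t ht => ⟨u', _, hu', ht⟩
    have htrue : ∀ i ≤ N, ∃ u, Sum.inr (i, true) ∈ H u := by
      intro i
      induction i with
      | zero =>
        intro _
        obtain ⟨v, hv⟩ := hH (Sum.inr (0, true))
        rcases hOpt _ _ hv with ⟨-, rfl⟩ | ⟨h, -⟩ | ⟨h, -⟩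
        · exact ⟨_, hv⟩
        · exact absurd h (lt_irrefl 0)
        · exact absurd h N.not_lt_zero
      | succ i h =>
        intro hi
        obtain ⟨u, hu⟩ := h (by omega)
        obtain ⟨v, hv⟩ := hH (Sum.inr (i + 1, true))
        rcases hOpt _ _ hv with ⟨-, rfl⟩ | ⟨-, -, rfl⟩ | ⟨h, -⟩
        · exact ⟨_, hv⟩
        · exact absurd hv (hne i _ _ hu)
        · exact absurd hi h.not_ge
    obtain ⟨u, hu⟩ := htrue N le_rfl
    obtain ⟨v, hv⟩ := hH (Sum.inr (N + 1, true))
    have hlt : ¬ N + 1 ≤ N := by omega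
    rcases hOpt _ _ hv with ⟨h, -⟩ | ⟨-, h, -⟩ | ⟨-, rfl⟩
    · exact hlt h
    · exact hlt h
    · exact hne N _ _ hu hv
  let U : Ultrafilter ℕ := hyperfilter ℕ
  have hlt : ∀ l, ∀ᶠ N : ℕ in U, l < N := fun l =>
    Nat.hyperfilter_le_atTop (eventually_gt_atTop l)
  let W : ℕ → Set (Fin k → A × ℕ) := fun p =>
    {t | ∃ m, t ∈ copies R (fun i => (Y (decide (i < p)) : Set (Fin k → A))) m}
  have hW : ∀ p, D.Mem (A × ℕ) (W p) := fun p =>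
    hdc.mem_copies hD hDI ih hR (Y := fun i => Y (decide (i < p))) (fun i => hY _) fun i => hYR _
  have hPW : ∀ p i, P i (decide (i < p)) ⊆ W p := fun p i =>
    Set.union_subset (fun t ht => ⟨0, Or.inl ht⟩) fun t ht =>
      ⟨i + 1, Or.inr ⟨i, i.lt_succ_self, ht⟩⟩
  have hsel : D.Selectable (ultraOpt U Opt) (ultraOption U fun _ => O) := by
    refine ⟨fun u => {v | ultraOpt U Opt u v ∧
      ((∃ l : ℕ, v = ultraMk U fun _ => Sum.inr (l, true)) ∨
        ∃ g : ℕ → ℕ, v = (ultraMk U fun N => Sum.inr (g N, false)) ∧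
          ∀ l, ∀ᶠ N in U, l < g N)}, fun u => ?_, fun u v hv => hv.1, ?_⟩
    · obtain ⟨f, rfl⟩ := ultraMk_surjective U u
      by_cases hl : ∃ l, ∀ᶠ N in U, idx (f N) = l
      · obtain ⟨l, hl⟩ := hl
        refine ⟨_, ultraOpt_iff.2 ?_, Or.inl ⟨l, rfl⟩⟩
        filter_upwards [hl, hlt l] with N h₁ h₂
        exact Or.inl ⟨by omega, by rw [h₁]⟩
      · push Not at hl
        have hlt' : ∀ l, ∀ᶠ N in U, l < idx (f N) := by
          intro l
          have : ∀ᶠ N in U, ∀ j : Fin (l + 1), idx (f N) ≠ j :=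
            eventually_all.2 fun j => hl j
          filter_upwards [this] with N hN
          by_contra h
          exact hN ⟨idx (f N), by omega⟩ rfl
        refine ⟨_, ultraOpt_iff.2 ?_, Or.inr ⟨fun N => if idx (f N) ≤ N then idx (f N) - 1 else N,
          rfl, fun l => ?_⟩⟩
        · filter_upwards [hlt' 0] with N hN
          by_cases h : idx (f N) ≤ N
          · exact Or.inr (Or.inl ⟨hN, h, by rw [if_pos h]⟩)
          · exact Or.inr (Or.inr ⟨not_le.1 h, by rw [if_neg h]⟩)
        · filter_upwards [hlt' (l + 1), hlt l] with N h₁ h₂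
          split_ifs <;> omega
    · refine hdc.mem_of_eventually hD hDI (U := U)
        (W := fun p => ultraRel U fun _ => (Sum.inl ∘ ·) '' W p) (fun p => ?_) ?_
      · rw [hD.mem_ultraRel_iff]
        refine Eventually.of_forall fun _ => ?_
        rw [hDI.mem_image_injective_iff Sum.inl_injective]
        exact hW p
      · rintro t ⟨u, _, ⟨-, ⟨l, rfl⟩ | ⟨g, rfl, hg⟩⟩, ht⟩
        · rw [ultraOption_mk] at ht
          filter_upwards [hlt l] with p hp
          refine ultraRel_mono U (Eventually.of_forall fun _ => Set.image_mono ?_) ht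
          simpa [hp] using hPW p l
        · rw [ultraOption_mk] at ht
          refine Eventually.of_forall fun p => ultraRel_mono U ?_ ht
          filter_upwards [hg p] with N hN
          refine Set.image_mono ?_
          simpa [hN.not_gt] using hPW p (g N)
  obtain ⟨N, hN⟩ := (hD.selectable_ultraproduct_iff.1 hsel).exists
  exact hnot N hN

theorem Dependency.DownwardsClosed.mem_union_near (n : ℕ) :
    ∀ (A : Type) [Nonempty A] (R : Set (Fin k → A)), D.Mem A R →
      ∀ Y : Finset (Fin k → A), Y.card ≤ n → (∀ t ∈ Y, Near R t) → D.Mem A (R ∪ Y) := by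
  classical
  induction n with
  | zero =>
    intro A _ R hR Y hY _
    rwa [Finset.card_eq_zero.1 (Nat.le_zero.1 hY), Finset.coe_empty, Set.union_empty]
  | succ n ih =>
    intro A _ R hR Y hY hYR
    rcases Y.eq_empty_or_nonempty with rfl | ⟨y, hy⟩
    · rwa [Finset.coe_empty, Set.union_empty]
    rcases Nat.eq_zero_or_pos n with rfl | hn
    · have hY : Y = {y} := Finset.eq_singleton_iff_unique_mem.2
        ⟨hy, fun z hz => Finset.card_le_one.1 hY z hz y hy⟩
      obtain ⟨B, _, f, R₁, t₁, -, h₁, h₂, h₃, -, h₄⟩ := (hYR y hy).exists_extension hD hDI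
      rw [hY, Finset.coe_singleton, Set.union_singleton, ← h₄]
      exact hdc _ _ _ (h₃ hR) (Set.insert_subset h₁ h₂)
    · have := hdc.mem_union_of_two_blocks hD hDI ih hR
        (Y := fun b => if b then Y.erase y else {y}) ?_ ?_
      · convert this using 2
        ext t
        by_cases ht : t = y <;> simp [ht, hy]
      · rintro (_ | _)
        · simpa using Nat.succ_le_of_lt hn
        · simp only [if_true, Finset.card_erase_of_mem hy]
          omega
      · rintro (_ | _) t ht
        · exact Finset.mem_singleton.1 ht ▸ hYR y hy
        · exact hYR t (Finset.mem_of_mem_erase ht)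

theorem Dependency.DownwardsClosed.not_bad (R : Set (Fin k → A)) : ¬ D.Bad R := by
  intro hR
  obtain ⟨B, _, h, S, hh, hRS, hS, hnear⟩ := hR.exists_near hD hDI
  obtain ⟨U, hU⟩ := exists_ultrafilter_finset (Fin k → B)
  refine hS (hdc.mem_of_eventually hD hDI (U := U) (W := fun F => F ∩ S) (fun F => ?_)
    fun t ht => (hU t).mono fun F hF => ⟨hF, ht⟩)
  classical
  have := hdc.mem_union_near hD hDI _ B _ (hR.image hDI hh).1 (F.filter (· ∈ S)) le_rfl
    fun t ht => hnear t (Finset.mem_filter.1 ht).2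
  refine hdc _ _ _ this fun t ht => Or.inr ?_
  simpa using ht

end Downwards

/-- Let `𝒟` be a family of domain-independent dependencies, each of which is union closed,
upwards closed, or downwards closed. Then `𝒟` is strongly first order iff every `D ∈ 𝒟` is
individually strongly first order. -/
theorem family_stronglyFirstOrder_iff {ι : Type} (Ds : ι → (k : ℕ) × Dependency k)
    (hdi : ∀ i, (Ds i).2.DomainIndependent)
    (hcl : ∀ i, (Ds i).2.UnionClosed ∨ (Ds i).2.UpwardsClosed ∨ (Ds i).2.DownwardsClosed) :
    StronglyFirstOrderFamily Ds ↔ ∀ i, StronglyFirstOrder (Ds i).2 := by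
  refine ⟨fun h i => h.stronglyFirstOrder i, fun h =>
    StronglyFirstOrderFamily.of_patternDefinable fun i => (h i).patternDefinable fun A _ R => ?_⟩
  rcases hcl i with hU | hU | hD
  · exact hU.not_bad (h i) (hdi i) R
  · exact hU.not_bad (h i) (hdi i) R
  · exact hD.not_bad (h i) (hdi i) R
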